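/- For any odd prime p, the Laurent series Θ_p(t) ∈ F_p((t^{-1})) is a quadratic irrational and exhibits exactly 2/p escape of mass with respect to the sequence {t^k}_{k≥0}; that is, lim_{n→∞} liminf_{k→∞} (Σ_{i=1}^{ℓ_{Θ_p·t^k}} max{deg A_i^{[Θ_p·t^k]} − n, 0}) / (Σ_{i=1}^{ℓ_{Θ_p·t^k}} deg A_i^{[Θ_p·t^k]}) = 2/p. -/

import Mathlib

open scoped Classical
open Filter Polynomial

noncomputable section

namespace EscapeOfMass

variable {K : Type*} [Field K]

/-- The element `t` of `K((t⁻¹))`, modelled as the Laurent series field `K⸨X⸩`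
in the variable `X = t⁻¹`; thus `t = X⁻¹ = single (-1) 1`. -/
def tLS (K : Type*) [Field K] : LaurentSeries K := HahnSeries.single (-1 : ℤ) 1

/-- The polynomial part of a Laurent series in `K((t⁻¹))` (the terms with
non-negative powers of `t`, i.e. non-positive powers of `X`). -/
def polyPart (f : LaurentSeries K) : LaurentSeries K :=
  { coeff := fun n => if n ≤ 0 then f.coeff n else 0
    isPWO_support' := by
      refine f.isPWO_support'.mono fun n hn => ?_
      simp only [Function.mem_support, ne_eq] at hn ⊢
      intro h
      exact hn (by simp [h]) }

/-- The fractional part `⟨f⟩` of a Laurent series in `K((t⁻¹))`. -/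
def fracPart (f : LaurentSeries K) : LaurentSeries K := f - polyPart f

/-- The complete quotients of the continued fraction expansion of `f`. -/
def cfQuot (f : LaurentSeries K) : ℕ → LaurentSeries K
  | 0 => f
  | i + 1 => (cfQuot f i - polyPart (cfQuot f i))⁻¹

/-- The partial quotients `A_i` of the continued fraction expansion of `f`. -/
def cfPQ (f : LaurentSeries K) (i : ℕ) : LaurentSeries K := polyPart (cfQuot f i)

/-- The degree (as an integer) of a Laurent series viewed in `K((t⁻¹))`:
for a nonzero polynomial in `t` this is the usual degree. -/
def degZ (f : LaurentSeries K) : ℤ := -f.order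

/-- `f` is a rational Laurent series, i.e. lies in `K(t)`. -/
def IsRatLS (f : LaurentSeries K) : Prop := ∃ r : RatFunc K, (r : LaurentSeries K) = f

/-- `f` is a quadratic irrational: it is irrational and a root of a quadratic
polynomial with coefficients in `K[t]`. -/
def IsQuadIrr (f : LaurentSeries K) : Prop :=
  ¬ IsRatLS f ∧ ∃ a b c : Polynomial K, a ≠ 0 ∧
    Polynomial.aeval (tLS K) a * f ^ 2 + Polynomial.aeval (tLS K) b * f +
      Polynomial.aeval (tLS K) c = 0

/-- `(m, ℓ)` is a window for the periodic part of the continued fraction of `f`: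
the partial quotients are periodic with period `ℓ ≥ 1` from index `m + 1` on. -/
def PeriodWindow (f : LaurentSeries K) (m ℓ : ℕ) : Prop :=
  1 ≤ ℓ ∧ ∀ i : ℕ, m + 1 ≤ i → cfPQ f (i + ℓ) = cfPQ f i

/-- The `n`-escape of mass of the continued fraction expansion of `f`: the proportion,
within one period of the periodic part of the partial quotients of `f`, of the sum
`∑ max (deg A_i - n) 0` relative to `∑ deg A_i`. -/
def eMassOf (f : LaurentSeries K) (n : ℕ) : ℝ :=
  if h : ∃ s : ℕ × ℕ, PeriodWindow f s.1 s.2 then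
    (∑ i ∈ Finset.Ico ((Classical.choose h).1 + 1)
        ((Classical.choose h).1 + 1 + (Classical.choose h).2),
        max ((degZ (cfPQ f i) : ℝ) - n) 0) /
    (∑ i ∈ Finset.Ico ((Classical.choose h).1 + 1)
        ((Classical.choose h).1 + 1 + (Classical.choose h).2),
        (degZ (cfPQ f i) : ℝ))
  else 0

/-- The `n`-escape of mass in the `k`-th diagonal of `f` with respect to the
sequence `{g^k}`. -/
def eMassP (g f : LaurentSeries K) (k n : ℕ) : ℝ := eMassOf (g ^ k * f) n

/-- The `n`-escape of mass in the `k`-th diagonal of `f` with respect to `{t^k}`. -/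
def eMass (f : LaurentSeries K) (k n : ℕ) : ℝ := eMassP (tLS K) f k n

/-- `f` exhibits `c` escape of mass with respect to the sequence `{g^k}`. -/
def ExhibitsEscape (g f : LaurentSeries K) (c : ℝ) : Prop :=
  ∃ L : ℝ, Tendsto (fun n : ℕ => Filter.liminf (fun k : ℕ => eMassP g f k n) atTop)
    atTop (nhds L) ∧ c ≤ L

/-- `f` exhibits exactly `c` escape of mass with respect to the sequence `{g^k}`. -/
def ExhibitsExactEscape (g f : LaurentSeries K) (c : ℝ) : Prop :=
  Tendsto (fun n : ℕ => Filter.liminf (fun k : ℕ => eMassP g f k n) atTop)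
    atTop (nhds c)

/-- `f` exhibits full (`c = 1`) maximal escape of mass with respect to `{g^k}`. -/
def ExhibitsFullMaxEscape (g f : LaurentSeries K) : Prop :=
  Tendsto (fun n : ℕ => Filter.limsup (fun k : ℕ => eMassP g f k n) atTop)
    atTop (nhds 1)

/-- `A ⊆ ℕ` has natural density `c`. -/
def HasDensity (A : Set ℕ) (c : ℝ) : Prop :=
  Tendsto (fun M : ℕ => (((Finset.Icc 1 M).filter fun k => k ∈ A).card : ℝ) / M)
    atTop (nhds c)

/-- `f` exhibits full generic escape of mass with respect to `{t^k}`. -/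
def FullGenericEscape (f : LaurentSeries K) : Prop :=
  ∀ ε : ℝ, 0 < ε → ∃ dens : ℕ → ℝ,
    (∀ n : ℕ, HasDensity {k : ℕ | 1 - ε < eMass f k n} (dens n)) ∧
    Tendsto dens atTop (nhds 1)

/-- Substitution `t ↦ P(t)` on Laurent series: for `f = ∑_{i ≥ d} a_i t^{-i}` (with
`d = f.order` in the variable `X = t⁻¹`), `substLS f P = ∑_{i ≥ d} a_i P(t)^{-i}`. -/
def substLS (f : LaurentSeries K) (P : Polynomial K) : LaurentSeries K :=
  (Polynomial.aeval (tLS K) P)⁻¹ ^ f.order *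
    HahnSeries.ofPowerSeries ℤ K
      (PowerSeries.mk fun n =>
        ∑ j ∈ Finset.range (n + 1),
          f.coeff (f.order + j) * (((Polynomial.aeval (tLS K) P)⁻¹ ^ j).coeff (n : ℤ)))

/-- The `p`-Cantor sequence over `ZMod p`. -/
def cantor (p : ℕ) : ℕ → ZMod p
  | 0 => 1
  | (n + 1) =>
    if hp : 1 < p then
      if (n + 1) % p % 2 = 1 then 0
      else (((p - 1) / 2).choose (((n + 1) % p) / 2) : ZMod p) * cantor p ((n + 1) / p)
    else 0
  decreasing_by exact Nat.div_lt_self (Nat.succ_pos _) hp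

/-- `Θ̃_p = ∑_{i ≥ 0} c_i^{(p)} t^{-i}`. -/
def cantorTilde (p : ℕ) : LaurentSeries (ZMod p) :=
  HahnSeries.ofPowerSeries ℤ (ZMod p) (PowerSeries.mk fun i => cantor p i)

/-- `Θ_p = t⁻¹ ∑_{i ≥ 0} c_i^{(p)} t^{-i}`. -/
def cantorTheta (p : ℕ) : LaurentSeries (ZMod p) :=
  HahnSeries.single (1 : ℤ) 1 * cantorTilde p

/-- The Thue–Morse sequence over `ZMod 2`. -/
def thueMorse (n : ℕ) : ZMod 2 := ((Nat.digits 2 n).sum : ZMod 2)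

/-- The Thue–Morse Laurent series `τ = ∑_{n ≥ 1} τ_n t^{-n}`. -/
def tmSeries : LaurentSeries (ZMod 2) :=
  HahnSeries.ofPowerSeries ℤ (ZMod 2) (PowerSeries.mk fun n => thueMorse n)

/-- The extension of a one-sided sequence to `ℤ` by zero. -/
def extendSeq (S : ℕ → K) : ℤ → K := fun i => if 0 ≤ i then S i.toNat else 0

/-- The entry `W(S)[m, n]` of the number wall of the (doubly infinite) sequence `s`:
the determinant of the `(m+1) × (m+1)` Toeplitz matrix `(s_{n - i + j})`. -/
def wallEntry (s : ℤ → K) (m : ℕ) (n : ℤ) : K :=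
  (Matrix.of fun i j : Fin (m + 1) => s (n - (i : ℕ) + (j : ℕ))).det

/-- The Laurent series `t⁻¹ ∑_{i ≥ 0} s_i t^{-i}` associated to a sequence. -/
def seriesOf (S : ℕ → K) : LaurentSeries K :=
  HahnSeries.single (1 : ℤ) 1 * HahnSeries.ofPowerSeries ℤ K (PowerSeries.mk S)

/-- The coefficient sequence of `Θ = t⁻¹ ∑ s_i t^{-i}`, extended to `ℤ` by zero. -/
def coeffSeq (f : LaurentSeries K) : ℤ → K := fun i => if 0 ≤ i then f.coeff (i + 1) else 0

/-- The absolute value of a Laurent series in `F_q((t⁻¹))`: `|f| = q^{deg f}`. -/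
def absLS {K : Type*} [Field K] [Fintype K] (f : LaurentSeries K) : ℝ :=
  if f = 0 then 0 else (Fintype.card K : ℝ) ^ (-f.order)


/-- degree at most `n`. -/
def Dle (f : LaurentSeries K) (n : ℤ) : Prop := ∀ m : ℤ, m < -n → f.coeff m = 0

/-- degree exactly `n`. -/
def Deq (f : LaurentSeries K) (n : ℤ) : Prop := f ≠ 0 ∧ f.order = -n

theorem Dle.zero (n : ℤ) : Dle (0 : LaurentSeries K) n := fun m _ => by simp

theorem dle_iff {f : LaurentSeries K} (hf : f ≠ 0) (n : ℤ) : Dle f n ↔ -n ≤ f.order := by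
  constructor
  · intro h
    by_contra hlt
    push Not at hlt
    exact hf (HahnSeries.coeff_order_eq_zero.mp (h _ hlt))
  · intro h m hm
    exact HahnSeries.coeff_eq_zero_of_lt_order (lt_of_lt_of_le hm h)

theorem Dle.mono {f : LaurentSeries K} {n n' : ℤ} (h : Dle f n) (hn : n ≤ n') : Dle f n' :=
  fun m hm => h m (by omega)

theorem Dle.add {f g : LaurentSeries K} {n : ℤ} (hf : Dle f n) (hg : Dle g n) : Dle (f + g) n :=
  fun m hm => by simp [hf m hm, hg m hm]

theorem Dle.neg {f : LaurentSeries K} {n : ℤ} (hf : Dle f n) : Dle (-f) n :=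
  fun m hm => by simp [hf m hm]

theorem Dle.sub {f g : LaurentSeries K} {n : ℤ} (hf : Dle f n) (hg : Dle g n) : Dle (f - g) n :=
  fun m hm => by simp [hf m hm, hg m hm]

theorem Dle.mul {f g : LaurentSeries K} {n m : ℤ} (hf : Dle f n) (hg : Dle g m) :
    Dle (f * g) (n + m) := by
  by_cases h1 : f = 0
  · subst h1; rw [zero_mul]; exact Dle.zero _
  by_cases h2 : g = 0
  · subst h2; rw [mul_zero]; exact Dle.zero _
  rw [dle_iff (mul_ne_zero h1 h2), HahnSeries.order_mul h1 h2]
  have := (dle_iff h1 n).mp hf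
  have := (dle_iff h2 m).mp hg
  omega

theorem Deq.dle {f : LaurentSeries K} {n : ℤ} (h : Deq f n) : Dle f n :=
  (dle_iff h.1 n).mpr (by rw [h.2])

theorem Deq.le {f : LaurentSeries K} {n m : ℤ} (h : Deq f n) (h' : Dle f m) : n ≤ m := by
  have := (dle_iff h.1 m).mp h'
  have := h.2
  omega

theorem Deq.mul {f g : LaurentSeries K} {n m : ℤ} (hf : Deq f n) (hg : Deq g m) :
    Deq (f * g) (n + m) :=
  ⟨mul_ne_zero hf.1 hg.1, by rw [HahnSeries.order_mul hf.1 hg.1, hf.2, hg.2]; ring⟩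

theorem Deq.pow {f : LaurentSeries K} {n : ℤ} (hf : Deq f n) (k : ℕ) :
    Deq (f ^ k) (k * n) :=
  ⟨pow_ne_zero _ hf.1, by rw [HahnSeries.order_pow, hf.2]; simp⟩

theorem Deq.neg {f : LaurentSeries K} {n : ℤ} (hf : Deq f n) : Deq (-f) n :=
  ⟨neg_ne_zero.mpr hf.1, by rw [HahnSeries.order_neg, hf.2]⟩

theorem Deq.add {f g : LaurentSeries K} {n m : ℤ} (hf : Deq f n) (hg : Dle g m) (hm : m < n) :
    Deq (f + g) n := by
  have hc : (f + g).coeff (-n) ≠ 0 := by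
    rw [HahnSeries.coeff_add, hg (-n) (by omega), add_zero, ← hf.2]
    exact fun h => hf.1 (HahnSeries.coeff_order_eq_zero.mp h)
  have h0 : f + g ≠ 0 := by
    intro h; rw [h] at hc; simp at hc
  refine ⟨h0, le_antisymm (HahnSeries.order_le_of_coeff_ne_zero hc) ?_⟩
  exact (dle_iff h0 n).mp (hf.dle.add (hg.mono hm.le))

theorem deq_self {f : LaurentSeries K} (hf : f ≠ 0) : Deq f (-f.order) := ⟨hf, by simp⟩

theorem Deq.inv {f : LaurentSeries K} {n : ℤ} (hf : Deq f n) : Deq (f⁻¹) (-n) := by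
  have h1 : f * f⁻¹ = 1 := mul_inv_cancel₀ hf.1
  refine ⟨inv_ne_zero hf.1, ?_⟩
  have := HahnSeries.order_mul hf.1 (inv_ne_zero hf.1)
  rw [h1, HahnSeries.order_one, hf.2] at this
  omega

theorem Deq.unique {f : LaurentSeries K} {n m : ℤ} (hf : Deq f n) (hg : Deq f m) : n = m := by
  have := hf.2; have := hg.2; omega

theorem deq_single (a : ℤ) {r : K} (hr : r ≠ 0) : Deq (HahnSeries.single a r) (-a) :=
  ⟨HahnSeries.single_ne_zero hr, by rw [HahnSeries.order_single hr]; simp⟩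

theorem deq_t : Deq (tLS K) 1 := by
  have := deq_single (K := K) (-1) one_ne_zero
  simpa [tLS] using this

theorem deq_one : Deq (1 : LaurentSeries K) 0 := ⟨one_ne_zero, by simp⟩

theorem tLS_pow (n : ℕ) : (tLS K) ^ n = HahnSeries.single (-(n : ℤ)) 1 := by
  rw [tLS, HahnSeries.single_pow]; simp

/-- polynomials in `t` -/
def IsP (f : LaurentSeries K) : Prop := ∃ P : K[X], aeval (tLS K) P = f

theorem IsP.add {f g : LaurentSeries K} (hf : IsP f) (hg : IsP g) : IsP (f + g) := by
  obtain ⟨P, rfl⟩ := hf; obtain ⟨Q, rfl⟩ := hg; exact ⟨P + Q, by simp⟩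
theorem IsP.sub {f g : LaurentSeries K} (hf : IsP f) (hg : IsP g) : IsP (f - g) := by
  obtain ⟨P, rfl⟩ := hf; obtain ⟨Q, rfl⟩ := hg; exact ⟨P - Q, by simp⟩
theorem IsP.mul {f g : LaurentSeries K} (hf : IsP f) (hg : IsP g) : IsP (f * g) := by
  obtain ⟨P, rfl⟩ := hf; obtain ⟨Q, rfl⟩ := hg; exact ⟨P * Q, by simp⟩
theorem IsP.neg {f : LaurentSeries K} (hf : IsP f) : IsP (-f) := by
  obtain ⟨P, rfl⟩ := hf; exact ⟨-P, by simp⟩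
theorem IsP.pow {f : LaurentSeries K} (hf : IsP f) (n : ℕ) : IsP (f ^ n) := by
  obtain ⟨P, rfl⟩ := hf; exact ⟨P ^ n, by simp⟩
theorem isP_zero : IsP (0 : LaurentSeries K) := ⟨0, by simp⟩
theorem isP_one : IsP (1 : LaurentSeries K) := ⟨1, by simp⟩
theorem isP_t : IsP (tLS K) := ⟨X, by simp⟩

theorem coeff_aeval_t (P : K[X]) (m : ℤ) :
    (aeval (tLS K) P).coeff m = if m ≤ 0 then P.coeff (-m).toNat else 0 := by
  induction P using Polynomial.induction_on' with
  | add p q hp hq => 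
    rw [map_add, HahnSeries.coeff_add, hp, hq]
    split_ifs <;> simp
  | monomial n a =>
    rw [aeval_monomial, tLS_pow]
    have : (algebraMap K (LaurentSeries K)) a = HahnSeries.single 0 a := by
      simp [HahnSeries.algebraMap_apply']
    rw [this, HahnSeries.single_mul_single, HahnSeries.coeff_single, coeff_monomial]
    by_cases hm : m ≤ 0
    · rw [if_pos hm]
      congr 1
      · rw [eq_iff_iff]; omega
      · simp
    · rw [if_neg hm, if_neg (by omega)]

theorem IsP.eq_zero {f : LaurentSeries K} (hf : IsP f) {n : ℤ} (h : Dle f n) (hn : n < 0) : f = 0 := by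
  obtain ⟨P, rfl⟩ := hf
  ext m
  by_cases hm : m ≤ 0
  · rw [h m (by omega)]; simp
  · rw [coeff_aeval_t, if_neg hm]; simp

theorem IsP.deg_nonneg {f : LaurentSeries K} (hf : IsP f) {n : ℤ} (h : Deq f n) : 0 ≤ n := by
  by_contra hn
  exact h.1 (hf.eq_zero h.dle (by omega))

theorem aeval_t_injective : Function.Injective (aeval (tLS K) : K[X] →ₐ[K] LaurentSeries K) := by
  rw [injective_iff_map_eq_zero]
  intro P hP
  ext n
  have := coeff_aeval_t P (-(n : ℤ))
  rw [hP] at this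
  simpa using this.symm

theorem dle_aeval_natDegree {P : K[X]} {n : ℕ} : Dle (aeval (tLS K) P) n ↔ P.natDegree ≤ n := by
  rw [natDegree_le_iff_coeff_eq_zero]
  constructor
  · intro h N hN
    have h1 := h (-(N : ℤ)) (by omega)
    rw [coeff_aeval_t, if_pos (by omega)] at h1
    simpa using h1
  · intro h m hm
    rw [coeff_aeval_t, if_pos (by omega)]
    exact h _ (by omega)

theorem isP_polyPart (f : LaurentSeries K) : IsP (polyPart f) := by
  refine ⟨∑ j ∈ Finset.range ((-f.order).toNat + 1), monomial j (f.coeff (-(j : ℤ))), ?_⟩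
  ext m
  rw [coeff_aeval_t]
  simp only [polyPart, finsetSum_coeff, coeff_monomial]
  by_cases hm : m ≤ 0
  · rw [if_pos hm, if_pos hm, Finset.sum_ite_eq']
    have : -(((-m).toNat : ℕ) : ℤ) = m := by omega
    rw [this]
    split_ifs with h
    · rfl
    · symm
      apply HahnSeries.coeff_eq_zero_of_lt_order
      simp at h
      omega
  · rw [if_neg hm, if_neg hm]

theorem dle_frac (f : LaurentSeries K) : Dle (f - polyPart f) (-1) := by
  intro m hm
  have : m ≤ 0 := by omega
  simp [polyPart, this]

theorem finite_bounded [Finite K] (N : ℕ) : {f : LaurentSeries K | IsP f ∧ Dle f N}.Finite := by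
  let φ : {f : LaurentSeries K | IsP f ∧ Dle f N} → (Fin (N + 1) → K) :=
    fun f i => f.1.coeff (-(i : ℤ))
  have hφ : Function.Injective φ := by
    rintro ⟨f, ⟨P, rfl⟩, hf⟩ ⟨g, ⟨Q, rfl⟩, hg⟩ h
    apply Subtype.ext
    ext m
    show (aeval (tLS K) P).coeff m = (aeval (tLS K) Q).coeff m
    by_cases hm : m < -N
    · rw [hf m hm, hg m hm]
    · by_cases hm' : m ≤ 0
      · have := congrFun h ⟨(-m).toNat, by omega⟩
        simp only [φ] at this
        have h2 : -(((-m).toNat : ℕ) : ℤ) = m := by omega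
        rwa [h2] at this
      · rw [coeff_aeval_t, coeff_aeval_t, if_neg hm', if_neg hm']
  exact Finite.of_injective φ hφ

/-- irrationality in terms of polynomials in `t`. -/
def Irr (α : LaurentSeries K) : Prop :=
  ∀ Q P : LaurentSeries K, IsP Q → IsP P → Q ≠ 0 → Q * α - P ≠ 0

def cQ (α : LaurentSeries K) : ℕ → LaurentSeries K
  | 0 => 0
  | 1 => 1
  | i + 2 => cfPQ α (i + 1) * cQ α (i + 1) + cQ α i

def cP (α : LaurentSeries K) : ℕ → LaurentSeries K
  | 0 => 1
  | 1 => cfPQ α 0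
  | i + 2 => cfPQ α (i + 1) * cP α (i + 1) + cP α i

def cF (α : LaurentSeries K) (i : ℕ) : LaurentSeries K := cQ α i * α - cP α i

def ee (α : LaurentSeries K) (i : ℕ) : ℕ := (degZ (cfPQ α i)).toNat

def dd (α : LaurentSeries K) (i : ℕ) : ℕ := ∑ j ∈ Finset.range i, ee α (j + 1)

theorem dd_succ (α : LaurentSeries K) (i : ℕ) : dd α (i + 1) = dd α i + ee α (i + 1) := by
  rw [dd, Finset.sum_range_succ]; rfl

theorem isP_cQ (α : LaurentSeries K) : ∀ i, IsP (cQ α i)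
  | 0 => isP_zero
  | 1 => isP_one
  | i + 2 => ((isP_polyPart _).mul (isP_cQ α (i + 1))).add (isP_cQ α i)

theorem isP_cP (α : LaurentSeries K) : ∀ i, IsP (cP α i)
  | 0 => isP_one
  | 1 => isP_polyPart _
  | i + 2 => ((isP_polyPart _).mul (isP_cP α (i + 1))).add (isP_cP α i)

theorem cF_succ (α : LaurentSeries K) (i : ℕ) :
    cF α (i + 2) = cfPQ α (i + 1) * cF α (i + 1) + cF α i := by
  simp only [cF, cQ, cP]; ring

theorem c_det (α : LaurentSeries K) (i : ℕ) :
    cQ α i * cP α (i + 1) - cP α i * cQ α (i + 1) = (-1) ^ (i + 1) := by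
  induction i with
  | zero => simp [cQ, cP]
  | succ i ih =>
    rw [pow_succ, ← ih]
    simp only [cQ, cP]
    ring

theorem quot_facts {α : LaurentSeries K} {i : ℕ} (h : cfQuot α i - polyPart (cfQuot α i) ≠ 0) :
    Deq (cfQuot α (i + 1)) (ee α (i + 1)) ∧ Deq (cfPQ α (i + 1)) (ee α (i + 1)) ∧
      1 ≤ ee α (i + 1) := by
  set g := cfQuot α i - polyPart (cfQuot α i) with hg
  have h1 : Deq g (-g.order) := deq_self h
  have h2 : -g.order ≤ -1 := h1.le (dle_frac _)
  have h3 : Deq (cfQuot α (i + 1)) g.order := by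
    have := h1.inv
    rwa [neg_neg] at this
  have h4 : Deq (cfPQ α (i + 1)) g.order := by
    have h5 := h3.add (dle_frac (cfQuot α (i + 1))).neg (by omega)
    have : cfQuot α (i + 1) + -(cfQuot α (i + 1) - polyPart (cfQuot α (i + 1)))
      = cfPQ α (i + 1) := by rw [cfPQ]; ring
    rwa [this] at h5
  have h6 : (ee α (i + 1) : ℤ) = g.order := by
    rw [ee, degZ, h4.2]; omega
  rw [h6]
  exact ⟨h3, h4, by omega⟩

theorem cf_main {α : LaurentSeries K} (hα : Irr α) (i : ℕ) :
    Deq (cQ α (i + 1)) (dd α i) ∧ Dle (cQ α i) (dd α i - 1) ∧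
    cfQuot α (i + 1) * cF α (i + 1) = - cF α i ∧
    cfQuot α i - polyPart (cfQuot α i) ≠ 0 ∧ Deq (cF α i) (-dd α i) := by
  induction i with
  | zero =>
    have h0 : cfQuot α 0 - polyPart (cfQuot α 0) ≠ 0 := by
      have := hα 1 (polyPart α) isP_one (isP_polyPart _) one_ne_zero
      rwa [one_mul] at this
    refine ⟨?_, ?_, ?_, h0, ?_⟩
    · simpa [cQ, dd] using deq_one
    · simpa [cQ] using Dle.zero _
    · have : cF α 1 = cfQuot α 0 - polyPart (cfQuot α 0) := by simp [cF, cQ, cP, cfPQ, cfQuot]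
      rw [this, show cfQuot α (0 + 1) = (cfQuot α 0 - polyPart (cfQuot α 0))⁻¹ from rfl,
        inv_mul_cancel₀ h0]
      simp [cF, cQ, cP]
    · have : cF α 0 = -1 := by simp [cF, cQ, cP]
      rw [this]
      simpa [dd] using deq_one.neg
  | succ i ih =>
    obtain ⟨ha, hb, hc, hd, he⟩ := ih
    obtain ⟨f1, f2, f3⟩ := quot_facts hd
    have ha' : Deq (cQ α (i + 2)) (dd α (i + 1)) := by
      have := (f2.mul ha).add hb (by omega)
      rw [dd_succ]; push_cast
      rw [add_comm (dd α i : ℤ)]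
      exact this
    have hF : cF α (i + 2) ≠ 0 := hα _ _ (isP_cQ _ _) (isP_cP _ _) ha'.1
    have hF2 : cF α (i + 2) = -(cfQuot α (i + 1) - polyPart (cfQuot α (i + 1))) * cF α (i + 1) := by
      have : cF α i = - (cfQuot α (i + 1) * cF α (i + 1)) := by rw [hc]; ring
      rw [cF_succ, this, cfPQ]; ring
    have hd' : cfQuot α (i + 1) - polyPart (cfQuot α (i + 1)) ≠ 0 := by
      intro h; rw [h] at hF2; simp at hF2; exact hF hF2
    refine ⟨ha', ha.dle.mono (by rw [dd_succ]; push_cast; omega), ?_, hd', ?_⟩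
    · rw [hF2, cfQuot]
      field_simp
    · have : cF α (i + 1) = (- cF α i) * (cfQuot α (i + 1))⁻¹ := by
        rw [← hc]; field_simp [f1.1]
      rw [this]
      have h2 := he.neg.mul f1.inv
      rw [dd_succ]; push_cast
      convert h2 using 1
      ring

theorem ee_pos {α : LaurentSeries K} (hα : Irr α) (i : ℕ) : 1 ≤ ee α (i + 1) :=
  (quot_facts (cf_main hα i).2.2.2.1).2.2

theorem degZ_eq {α : LaurentSeries K} (hα : Irr α) (i : ℕ) :
    degZ (cfPQ α (i + 1)) = (ee α (i + 1) : ℤ) := by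
  have := (quot_facts (cf_main hα i).2.2.2.1).2.1.2
  rw [degZ, this]; ring

/-- approximations of quality `s` at level `d` -/
def Appr (α : LaurentSeries K) (s d : ℕ) : Prop :=
  ∃ Q P : LaurentSeries K, IsP Q ∧ IsP P ∧ Q ≠ 0 ∧ Dle Q d ∧ Dle (Q * α - P) (-((d : ℤ) + s))

theorem appr_iff {α : LaurentSeries K} (hα : Irr α) {s d i : ℕ} (hs : 1 ≤ s) (h1 : dd α i ≤ d)
    (h2 : d < dd α (i + 1)) : Appr α s d ↔ d + s ≤ dd α (i + 1) := by
  obtain ⟨ha, -, -, -, -⟩ := cf_main hα i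
  obtain ⟨-, -, -, -, he⟩ := cf_main hα (i + 1)
  constructor
  · rintro ⟨Q, P, hQ, hP, hQ0, hd, hF⟩
    by_contra hlt
    have hW : IsP (Q * cP α (i + 1) - cQ α (i + 1) * P) :=
      (hQ.mul (isP_cP _ _)).sub ((isP_cQ _ _).mul hP)
    have hW0 : Q * cP α (i + 1) - cQ α (i + 1) * P = 0 := by
      refine hW.eq_zero (n := -1) ?_ (by omega)
      have e : Q * cP α (i + 1) - cQ α (i + 1) * P =
        cQ α (i + 1) * (Q * α - P) - Q * cF α (i + 1) := by rw [cF]; ring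
      rw [e]
      exact ((ha.dle.mul hF).mono (by omega)).sub ((hd.mul he.dle).mono (by omega))
    have hdet := c_det α i
    set R := (-1) ^ (i + 1) * (cQ α i * P - cP α i * Q) with hR
    have hRP : IsP R := by
      refine IsP.mul (isP_one.neg.pow _) (((isP_cQ _ _).mul hP).sub ((isP_cP _ _).mul hQ))
    have h11 : ((-1 : LaurentSeries K) ^ (i + 1)) * (-1) ^ (i + 1) = 1 := by
      rw [← mul_pow]; simp
    have hQR : Q = R * cQ α (i + 1) := by
      have : Q = (-1) ^ (i + 1) * (cQ α i * cP α (i + 1) - cP α i * cQ α (i + 1)) * Q := by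
        rw [hdet, h11, one_mul]
      rw [this, hR]
      linear_combination (-1) ^ (i + 1) * cQ α i * hW0
    have hPR : P = R * cP α (i + 1) := by
      have : P = (-1) ^ (i + 1) * (cQ α i * cP α (i + 1) - cP α i * cQ α (i + 1)) * P := by
        rw [hdet, h11, one_mul]
      rw [this, hR]
      linear_combination (-1) ^ (i + 1) * cP α i * hW0
    have hR0 : R ≠ 0 := by
      intro h; rw [h, zero_mul] at hQR; exact hQ0 hQR
    have hRd := hRP.deg_nonneg (deq_self hR0)
    have e : Q * α - P = R * cF α (i + 1) := by
      rw [cF]; nth_rewrite 1 [hQR]; nth_rewrite 1 [hPR]; ring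
    rw [e] at hF
    have := ((deq_self hR0).mul he).le hF
    omega
  · intro h
    exact ⟨cQ α (i + 1), cP α (i + 1), isP_cQ _ _, isP_cP _ _, ha.1, ha.dle.mono (by omega),
      he.dle.mono (by omega)⟩

theorem dd_mono (α : LaurentSeries K) : Monotone (dd α) :=
  monotone_nat_of_le_succ fun i => by rw [dd_succ]; omega

theorem card_appr {α : LaurentSeries K} (hα : Irr α) (n a L : ℕ) :
    ((Finset.Ico (dd α a) (dd α (a + L))).filter (Appr α (n + 1))).card =
      ∑ i ∈ Finset.Ico (a + 1) (a + 1 + L), (ee α i - n) := by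
  induction L with
  | zero => simp
  | succ L ih =>
    rw [← add_assoc (a + 1), Finset.sum_Ico_succ_top (by omega), ← ih, ← add_assoc a]
    rw [← Finset.Ico_union_Ico_eq_Ico (dd_mono α (by omega : a ≤ a + L))
      (dd_mono α (by omega : a + L ≤ a + L + 1)), Finset.filter_union,
      Finset.card_union_of_disjoint]
    · congr 1
      have : (Finset.Ico (dd α (a + L)) (dd α (a + L + 1))).filter (Appr α (n + 1)) =
          Finset.Ico (dd α (a + L)) (dd α (a + L + 1) - n) := by
        ext d
        simp only [Finset.mem_filter, Finset.mem_Ico]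
        constructor
        · rintro ⟨⟨h1, h2⟩, h3⟩
          have := (appr_iff hα (by omega) h1 h2).mp h3
          omega
        · rintro ⟨h1, h2⟩
          exact ⟨⟨h1, by omega⟩, (appr_iff hα (by omega) h1 (by omega)).mpr (by omega)⟩
      rw [this, Nat.card_Ico, dd_succ, show a + 1 + L = a + L + 1 by omega]
      omega
    · exact Finset.disjoint_filter_filter (Finset.Ico_disjoint_Ico_consecutive _ _ _)

theorem sum_periodic (g : ℕ → ℕ) (m l : ℕ) (h : ∀ i, m ≤ i → g (i + l) = g i) (L : ℕ) :
    ∑ i ∈ Finset.Ico m (m + L * l), g i = L * ∑ i ∈ Finset.Ico m (m + l), g i := by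
  have hp : ∀ L i, m ≤ i → g (i + L * l) = g i := by
    intro L
    induction L with
    | zero => intro i _; simp
    | succ L ih => 
      intro i hi
      rw [Nat.succ_mul, ← add_assoc, h _ (by omega), ih i hi]
  induction L with
  | zero => simp
  | succ L ih =>
    rw [Nat.succ_mul, Nat.succ_mul, ← ih, ← add_assoc,
      ← Finset.sum_Ico_consecutive _ (by omega : m ≤ m + L * l) (by omega)]
    congr 1
    have := Finset.sum_Ico_add' g m (m + l) (L * l)
    rw [show m + l + L * l = m + L * l + l by ring] at this
    rw [← this]
    apply Finset.sum_congr rfl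
    intro i hi
    exact hp L i (Finset.mem_Ico.mp hi).1

/-- The mass, expressed through densities. -/
theorem eMass_density {α : LaurentSeries K} (hα : Irr α)
    (hw : ∃ s : ℕ × ℕ, PeriodWindow α s.1 s.2) (n : ℕ) :
    ∃ N T a : ℕ, 0 < T ∧ eMassOf α n = (N : ℝ) / T ∧ N ≤ T ∧
      ∀ L, ((Finset.Ico a (a + L * T)).filter (Appr α (n + 1))).card = L * N := by
  have hw' := Classical.choose_spec hw
  set m := (Classical.choose hw).1 with hm
  set l := (Classical.choose hw).2 with hl
  obtain ⟨hl1, hper⟩ := hw'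
  have hee : ∀ i, m + 1 ≤ i → ee α (i + l) = ee α i := by
    intro i hi; rw [ee, ee, hper i hi]
  refine ⟨∑ i ∈ Finset.Ico (m + 1) (m + 1 + l), (ee α i - n),
    ∑ i ∈ Finset.Ico (m + 1) (m + 1 + l), ee α i, dd α m, ?_, ?_, ?_, ?_⟩
  · apply Finset.sum_pos
    · intro i hi
      have := (Finset.mem_Ico.mp hi).1
      obtain ⟨j, rfl⟩ : ∃ j, i = j + 1 := ⟨i - 1, by omega⟩
      exact ee_pos hα j
    · exact ⟨m + 1, by simp; omega⟩
  · rw [eMassOf, dif_pos hw, ← hm, ← hl]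
    have hd : ∀ i ∈ Finset.Ico (m + 1) (m + 1 + l), (degZ (cfPQ α i) : ℝ) = (ee α i : ℝ) := by
      intro i hi
      have := (Finset.mem_Ico.mp hi).1
      obtain ⟨j, rfl⟩ : ∃ j, i = j + 1 := ⟨i - 1, by omega⟩
      rw [degZ_eq hα j]; simp
    congr 1
    · rw [Nat.cast_sum]
      apply Finset.sum_congr rfl
      intro i hi
      rw [hd i hi]
      by_cases h : n ≤ ee α i
      · rw [Nat.cast_sub h, max_eq_left]
        have : (n : ℝ) ≤ ee α i := by exact_mod_cast h
        linarith
      · rw [Nat.sub_eq_zero_of_le (by omega), max_eq_right]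
        · simp
        · have : (ee α i : ℝ) ≤ n := by exact_mod_cast (by omega : ee α i ≤ n)
          linarith
    · rw [Nat.cast_sum]
      exact Finset.sum_congr rfl hd
  · exact Finset.sum_le_sum fun i _ => Nat.sub_le _ _
  · intro L
    rw [← sum_periodic _ (m + 1) l (fun i hi => hee i hi) L,
      ← sum_periodic _ (m + 1) l (fun i hi => by rw [hee i hi]) L, ← card_appr hα]
    congr 3

    have := Finset.sum_Ico_add' (ee α) m (m + L * l) 1
    rw [show m + L * l + 1 = m + 1 + L * l by ring] at this
    rw [← this, dd, dd, Finset.sum_range_add_sum_Ico _ (by omega)]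

theorem count_block (pr : ℕ → Prop) (q : ℕ) (hpr : Function.Periodic pr q) (a T : ℕ) :
    ((Finset.Ico a (a + q * T)).filter pr).card = T * q.count pr := by
  induction T with
  | zero => simp
  | succ T ih =>
    rw [← Finset.Ico_union_Ico_eq_Ico (by omega : a ≤ a + q * T)
      (by rw [Nat.mul_succ]; omega : a + q * T ≤ a + q * (T + 1)), Finset.filter_union,
      Finset.card_union_of_disjoint
        (Finset.disjoint_filter_filter (Finset.Ico_disjoint_Ico_consecutive _ _ _)), ih,
      Nat.mul_succ, ← add_assoc, Nat.filter_Ico_card_eq_of_periodic _ _ _ hpr]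
    ring

/-- Upper and lower bounds from periodic predicates. -/
theorem eMass_le {α : LaurentSeries K} (hα : Irr α)
    (hw : ∃ s : ℕ × ℕ, PeriodWindow α s.1 s.2) (n q : ℕ) (hq : 0 < q) (pr : ℕ → Prop)
    (hpr : Function.Periodic pr q) (h : ∀ d, Appr α (n + 1) d → pr d) :
    eMassOf α n ≤ (q.count pr : ℝ) / q := by
  obtain ⟨N, T, a, hT, he, -, hc⟩ := eMass_density hα hw n
  rw [he, div_le_div_iff₀ (by exact_mod_cast hT) (by exact_mod_cast hq)]
  have h1 := hc q
  have h2 : ((Finset.Ico a (a + q * T)).filter (Appr α (n + 1))).card ≤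
      ((Finset.Ico a (a + q * T)).filter pr).card :=
    Finset.card_le_card (Finset.monotone_filter_right _ (fun d _ => h d))
  rw [h1, count_block pr q hpr] at h2
  have h3 : N * q ≤ q.count pr * T := by nlinarith
  exact_mod_cast h3

theorem eMass_ge {α : LaurentSeries K} (hα : Irr α)
    (hw : ∃ s : ℕ × ℕ, PeriodWindow α s.1 s.2) (n q : ℕ) (hq : 0 < q) (pr : ℕ → Prop)
    (hpr : Function.Periodic pr q) (h : ∀ d, pr d → Appr α (n + 1) d) :
    (q.count pr : ℝ) / q ≤ eMassOf α n := by
  obtain ⟨N, T, a, hT, he, -, hc⟩ := eMass_density hα hw n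
  rw [he, div_le_div_iff₀ (by exact_mod_cast hq) (by exact_mod_cast hT)]
  have h1 := hc q
  have h2 : ((Finset.Ico a (a + q * T)).filter pr).card ≤
      ((Finset.Ico a (a + q * T)).filter (Appr α (n + 1))).card :=
    Finset.card_le_card (Finset.monotone_filter_right _ (fun d _ => h d))
  rw [h1, count_block pr q hpr] at h2
  have h3 : q.count pr * T ≤ N * q := by nlinarith
  exact_mod_cast h3

theorem cantor_rec (p : ℕ) (hp : 1 < p) (n : ℕ) : cantor p n =
    if n % p % 2 = 1 then 0
      else (((p - 1) / 2).choose ((n % p) / 2) : ZMod p) * cantor p (n / p) := by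
  cases n with
  | zero => simp [cantor]
  | succ n =>
    conv_lhs => rw [cantor]
    rw [dif_pos hp]

theorem coeff_one_add_X_sq (R : Type*) [CommRing R] (h i : ℕ) :
    (((1 + X ^ 2) ^ h : R[X])).coeff i = if i % 2 = 1 then 0 else ((h.choose (i / 2) : ℕ) : R) := by
  have : ((1 + X ^ 2) ^ h : R[X]) = Polynomial.expand R 2 ((1 + X) ^ h) := by simp
  rw [this, Polynomial.coeff_expand (by norm_num), Polynomial.coeff_one_add_X_pow]
  by_cases hi : i % 2 = 1
  · rw [if_pos hi, if_neg (by omega)]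
  · rw [if_neg hi, if_pos (by omega)]

theorem cantor_frob (p : ℕ) [hp : Fact p.Prime] (hodd : Odd p) :
    (PowerSeries.mk (cantor p)) =
      (1 + PowerSeries.X ^ 2) ^ ((p - 1) / 2) * (PowerSeries.mk (cantor p)) ^ p := by
  have hp0 : p ≠ 0 := hp.out.ne_zero
  have hE : (PowerSeries.mk (cantor p)) ^ p = PowerSeries.expand p hp0 (PowerSeries.mk (cantor p)) := by
    have := MvPowerSeries.map_frobenius_expand (σ := Unit) (R := ZMod p) p hp0
      (f := PowerSeries.mk (cantor p))
    rw [ZMod.frobenius_zmod] at this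
    have h2 : PowerSeries.mk (cantor p) ^ p =
      (MvPowerSeries.map (RingHom.id (ZMod p)))
        (MvPowerSeries.expand p hp0 (PowerSeries.mk (cantor p))) := this.symm
    rw [h2]
    simp [PowerSeries.expand]
  have hpoly : ((1 + PowerSeries.X ^ 2) ^ ((p - 1) / 2) : PowerSeries (ZMod p)) =
      (((1 + X ^ 2) ^ ((p - 1) / 2) : (ZMod p)[X]) : PowerSeries (ZMod p)) := by simp
  have hpos := hp.out.pos
  rw [hE, hpoly]
  ext n
  rw [PowerSeries.coeff_mk, PowerSeries.coeff_mul, cantor_rec p hp.out.one_lt,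
    Finset.sum_eq_single (n % p, p * (n / p))]
  · simp only [Polynomial.coeff_coe]
    rw [PowerSeries.coeff_expand_mul, coeff_one_add_X_sq, PowerSeries.coeff_mk]
    split_ifs <;> simp
  · rintro ⟨i, j⟩ hij hne
    simp only [Polynomial.coeff_coe]
    rw [Finset.HasAntidiagonal.mem_antidiagonal] at hij
    simp only at hij
    by_cases hj : p ∣ j
    · obtain ⟨c, rfl⟩ := hj
      have hi : ¬ i < p := by
        intro hi
        apply hne
        have h1 : n % p = i := by
          rw [← hij, Nat.add_mul_mod_self_left, Nat.mod_eq_of_lt hi]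
        have h2 : n / p = c := by
          rw [← hij, Nat.add_mul_div_left _ _ hpos, Nat.div_eq_of_lt hi, zero_add]
        rw [h1, h2]
      rw [coeff_one_add_X_sq]
      split_ifs with hi2
      · simp
      · rw [Nat.choose_eq_zero_of_lt]
        · simp
        · have := Nat.odd_iff.mp hodd
          omega
    · rw [PowerSeries.coeff_expand_of_not_dvd _ _ _ hj, mul_zero]
  · intro h
    exact absurd (Finset.HasAntidiagonal.mem_antidiagonal.mpr (Nat.mod_add_div n p)) h

theorem cantor_sq (p : ℕ) [hp : Fact p.Prime] (hodd : Odd p) :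
    (1 + PowerSeries.X ^ 2) * (PowerSeries.mk (cantor p)) ^ 2 = 1 := by
  set c := PowerSeries.mk (cantor p) with hc
  set w := (1 + PowerSeries.X ^ 2) * c ^ 2 with hw
  obtain ⟨h, hh⟩ := hodd
  have hp1 := hp.out.one_lt
  have hf := cantor_frob p ⟨h, hh⟩
  rw [show (p - 1) / 2 = h by omega, ← hc] at hf
  have hc0 : PowerSeries.constantCoeff c = 1 := by
    rw [← PowerSeries.coeff_zero_eq_constantCoeff_apply, hc, PowerSeries.coeff_mk, cantor]
  have hcne : c ≠ 0 := by intro h; rw [h] at hc0; simp at hc0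
  have hw1 : w ^ h = 1 := by
    apply mul_right_cancel₀ hcne
    rw [one_mul]
    have hcp : c ^ p = c ^ (2 * h + 1) := congrArg (fun m => c ^ m) hh
    rw [hcp] at hf
    have : w ^ h * c = (1 + PowerSeries.X ^ 2) ^ h * c ^ (2 * h + 1) := by
      rw [hw, mul_pow, ← pow_mul, pow_succ c, mul_assoc]
    rw [this, ← hf]
  have hw0 : PowerSeries.constantCoeff w = 1 := by
    rw [hw]; simp [hc0]
  -- w ^ p = w * (w^h)^2 = w, so w is constant
  have hh0 : (h : ZMod p) ≠ 0 := by
    intro h0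
    rw [ZMod.natCast_eq_zero_iff] at h0
    have : 0 < h := by omega
    have := Nat.le_of_dvd this h0
    omega
  have hfac : (w - 1) * ∑ i ∈ Finset.range h, w ^ i = 0 := by
    rw [mul_comm, geom_sum_mul, hw1, sub_self]
  rcases mul_eq_zero.mp hfac with h1 | h1
  · exact sub_eq_zero.mp h1
  · exfalso
    have := congrArg PowerSeries.constantCoeff h1
    simp [hw0] at this
    exact hh0 this

theorem theta_sq (p : ℕ) [hp : Fact p.Prime] (hodd : Odd p) :
    ((tLS (ZMod p)) ^ 2 + 1) * cantorTheta p ^ 2 = 1 := by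
  have h := congrArg (HahnSeries.ofPowerSeries ℤ (ZMod p)) (cantor_sq p hodd)
  simp only [map_mul, map_add, map_pow, map_one, HahnSeries.ofPowerSeries_X] at h
  have ht : tLS (ZMod p) * HahnSeries.single (1 : ℤ) (1 : ZMod p) = 1 := by
    rw [tLS, HahnSeries.single_mul_single]; simp
  rw [cantorTheta, cantorTilde]
  set c := HahnSeries.ofPowerSeries ℤ (ZMod p) (PowerSeries.mk fun i => cantor p i)
  set x := HahnSeries.single (1 : ℤ) (1 : ZMod p)
  have h' : (1 + x ^ 2) * c ^ 2 = 1 := h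
  linear_combination h' + (tLS (ZMod p) * x + 1) * c ^ 2 * ht

theorem deq_theta (p : ℕ) [hp : Fact p.Prime] (hodd : Odd p) : Deq (cantorTheta p) (-1) := by
  have h := theta_sq p hodd
  have h1 : Deq (tLS (ZMod p) ^ 2 + 1) 2 := by
    have := (deq_t (K := ZMod p)).pow 2
    simpa using this.add deq_one.dle (by norm_num)
  have h0 : cantorTheta p ≠ 0 := by
    intro h0; rw [h0] at h; simp at h
  have h2 := (h1.mul ((deq_self h0).pow 2))
  rw [h] at h2
  have := h2.unique deq_one
  refine ⟨h0, ?_⟩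
  push_cast at this
  omega

theorem no_sqrt (p : ℕ) [hp : Fact p.Prime] (hodd : Odd p) (a b : (ZMod p)[X])
    (h : a ^ 2 = b ^ 2 * (X ^ 2 + 1)) : b = 0 := by
  by_contra hb
  have h2 : (2 : ZMod p) ≠ 0 := by
    have : ((2 : ℕ) : ZMod p) ≠ 0 := by
      rw [Ne, ZMod.natCast_eq_zero_iff]
      intro h
      have := (Nat.prime_dvd_prime_iff_eq hp.out Nat.prime_two).mp h
      subst this
      exact absurd hodd (by decide)
    exact_mod_cast this
  have hsep : (X ^ 2 + 1 : (ZMod p)[X]).Separable := by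
    have := separable_X_pow_sub_C_unit (R := ZMod p) (n := 2) (-1 : (ZMod p)ˣ)
      (by exact isUnit_iff_ne_zero.mpr (by exact_mod_cast h2))
    simpa using this
  have hsq := hsep.squarefree
  have hdvd : b ∣ a := by
    rw [← IsIntegrallyClosed.pow_dvd_pow_iff (n := 2) (by norm_num)]
    exact ⟨_, h⟩
  obtain ⟨c, rfl⟩ := hdvd
  have h3 : c ^ 2 = X ^ 2 + 1 := by
    apply mul_left_cancel₀ (pow_ne_zero 2 hb)
    rw [← h]; ring
  have hu := hsq c ⟨1, by rw [← h3]; ring⟩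
  have := natDegree_eq_zero_of_isUnit hu
  have h4 := congrArg natDegree h3
  rw [natDegree_pow, this] at h4
  have h5 : (X ^ 2 + 1 : (ZMod p)[X]).natDegree = 2 := by
    compute_degree!
  omega

theorem rat_gen (φ : RatFunc K →+* LaurentSeries K) (r : RatFunc K)
    (hX : φ RatFunc.X = HahnSeries.single (1 : ℤ) (1 : K))
    (h1 : (1 + (HahnSeries.single (1 : ℤ) (1 : K)) ^ 2) * (φ r) ^ 2 =
      (HahnSeries.single (1 : ℤ) (1 : K)) ^ 2) :
    (1 + X ^ 2) * r.num ^ 2 = X ^ 2 * r.denom ^ 2 := by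
  rw [← hX] at h1
  have h2 : (1 + RatFunc.X ^ 2) * r ^ 2 = RatFunc.X ^ 2 := by
    apply φ.injective
    simpa using h1
  have hd : (algebraMap K[X] (RatFunc K) r.denom) ≠ 0 := by
    simpa using r.denom_ne_zero
  rw [← RatFunc.num_div_denom r, div_pow] at h2
  rw [← mul_div_assoc, div_eq_iff (pow_ne_zero 2 hd)] at h2
  apply IsFractionRing.injective K[X] (RatFunc K)
  simpa using h2

theorem not_rat (p : ℕ) [hp : Fact p.Prime] (hodd : Odd p) : ¬ IsRatLS (cantorTheta p) := by
  rintro ⟨r, hr⟩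
  have h := theta_sq p hodd
  have ht : tLS (ZMod p) * HahnSeries.single (1 : ℤ) (1 : ZMod p) = 1 := by
    rw [tLS, HahnSeries.single_mul_single]; simp
  have h1 : (1 + (HahnSeries.single (1 : ℤ) (1 : ZMod p)) ^ 2) * cantorTheta p ^ 2 =
      (HahnSeries.single (1 : ℤ) (1 : ZMod p)) ^ 2 := by
    set x := HahnSeries.single (1 : ℤ) (1 : ZMod p)
    linear_combination x ^ 2 * h - (tLS (ZMod p) * x + 1) * cantorTheta p ^ 2 * ht
  rw [← hr] at h1
  have h3 := rat_gen _ r RatFunc.coe_X h1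
  have h4 := no_sqrt p hodd (X * r.denom) r.num (by rw [mul_pow, ← h3]; ring)
  rw [h4] at h3
  have h5 : (X ^ 2 * r.denom ^ 2 : (ZMod p)[X]) ≠ 0 :=
    mul_ne_zero (pow_ne_zero _ X_ne_zero) (pow_ne_zero _ r.denom_ne_zero)
  apply h5
  rw [← h3]; simp

theorem quadIrr (p : ℕ) [hp : Fact p.Prime] (hodd : Odd p) : IsQuadIrr (cantorTheta p) := by
  refine ⟨not_rat p hodd, X ^ 2 + 1, 0, -1, ?_, ?_⟩
  · exact (Monic.ne_zero (by monicity!))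
  · have := theta_sq p hodd
    simp [this]

theorem irr_tk (p : ℕ) [hp : Fact p.Prime] (hodd : Odd p) (k : ℕ) :
    Irr (tLS (ZMod p) ^ k * cantorTheta p) := by
  rintro Q P ⟨Q, rfl⟩ ⟨P, rfl⟩ hQ0 hF
  have h := theta_sq p hodd
  have h1 : (Q * X ^ k) ^ 2 = P ^ 2 * (X ^ 2 + 1) := by
    apply aeval_t_injective
    have : aeval (tLS (ZMod p)) P = aeval (tLS (ZMod p)) Q * (tLS (ZMod p) ^ k * cantorTheta p) :=
      (sub_eq_zero.mp hF).symm
    simp only [map_mul, map_pow, map_add, aeval_X, map_one, this]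
    linear_combination -(aeval (tLS (ZMod p)) Q) ^ 2 * (tLS (ZMod p) ^ k) ^ 2 * h
  have h2 := no_sqrt p hodd _ _ h1
  rw [h2] at h1
  have h3 : Q * X ^ k = 0 := by
    apply pow_eq_zero_iff (n := 2) (by norm_num) |>.mp
    rw [h1]; simp
  rcases mul_eq_zero.mp h3 with h4 | h4
  · apply hQ0; rw [h4]; simp
  · exact pow_ne_zero _ X_ne_zero h4

theorem window_gen [Finite K] {α D B : LaurentSeries K} (hα : Irr α) (k : ℕ) (hD : IsP D) (hB : IsP B)
    (hDB : D * α ^ 2 = B) (hD0 : D ≠ 0) (hd : Dle D 2) (hk : Dle α k) :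
    ∃ s : ℕ × ℕ, PeriodWindow α s.1 s.2 := by
  let S := {f : LaurentSeries K | IsP f ∧ Dle f ((k + 2 : ℕ) : ℤ)}
  have hS : S.Finite := finite_bounded (k + 2)
  let Y : ℕ → LaurentSeries K := fun i => B * cQ α (i + 1) ^ 2 - D * cP α (i + 1) ^ 2
  let Z : ℕ → LaurentSeries K := fun i =>
    -(cQ α i * cQ α (i + 1) * B - D * cP α i * cP α (i + 1))
  have hY : ∀ i, Y i = D * cF α (i + 1) * (cQ α (i + 1) * α + cP α (i + 1)) := by
    intro i
    simp only [Y, cF, ← hDB]; ring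
  have hZ : ∀ i, Z i + (-1) ^ i * (D * α) =
      - (D * cF α i * (cQ α (i + 1) * α + cP α (i + 1))) := by
    intro i
    have h := c_det α i
    rw [pow_succ] at h
    simp only [Z, cF, ← hDB]
    linear_combination (D * α) * h
  have hX : ∀ i, cfQuot α (i + 1) * Y i = Z i + (-1) ^ i * (D * α) := by
    intro i
    rw [hZ, hY]
    linear_combination (D * (cQ α (i + 1) * α + cP α (i + 1))) * (cf_main hα i).2.2.1
  have hs : ∀ i, Dle (cQ α (i + 1) * α + cP α (i + 1)) (dd α i + k) := by
    intro i
    have h1 : Dle (cQ α (i + 1) * α) (dd α i + k) := (cf_main hα i).1.dle.mul hk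
    have h2 : Dle (cF α (i + 1)) (dd α i + k) :=
      (cf_main hα (i + 1)).2.2.2.2.dle.mono (by omega)
    have : cQ α (i + 1) * α + cP α (i + 1) = cQ α (i + 1) * α + (cQ α (i + 1) * α - cF α (i + 1)) := by
      simp only [cF]; ring
    rw [this]
    exact h1.add (h1.sub h2)
  have hpow : ∀ i : ℕ, Dle ((-1 : LaurentSeries K) ^ i) 0 := by
    intro i
    have := (deq_one (K := K)).neg.pow i
    simpa using this.dle
  have hYS : ∀ i, Y i ∈ S := by
    intro i
    refine ⟨(hB.mul ((isP_cQ α _).pow 2)).sub (hD.mul ((isP_cP α _).pow 2)), ?_⟩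
    rw [hY]
    have := dd_mono α (Nat.le_succ i)
    refine ((hd.mul (cf_main hα (i + 1)).2.2.2.2.dle).mul (hs i)).mono ?_
    push_cast
    have : (dd α i : ℤ) ≤ dd α (i + 1) := by exact_mod_cast this
    omega
  have hZS : ∀ i, Z i ∈ S := by
    intro i
    refine ⟨((((isP_cQ α _).mul (isP_cQ α _)).mul hB).sub ((hD.mul (isP_cP α _)).mul (isP_cP α _))).neg, ?_⟩
    have h1 : Z i = - (D * cF α i * (cQ α (i + 1) * α + cP α (i + 1))) - (-1) ^ i * (D * α) := by
      rw [← hZ]; ring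
    rw [h1]
    refine Dle.sub (Dle.neg ?_) ?_
    · refine ((hd.mul (cf_main hα i).2.2.2.2.dle).mul (hs i)).mono ?_
      push_cast; omega
    · refine ((hpow i).mul (hd.mul hk)).mono ?_
      push_cast; omega
  have hY0 : ∀ i, Y i ≠ 0 := by
    intro i
    rw [hY]
    refine mul_ne_zero (mul_ne_zero hD0 (cf_main hα (i + 1)).2.2.2.2.1) ?_
    have := hα (cQ α (i + 1)) (-cP α (i + 1)) (isP_cQ α _) (isP_cP α _).neg (cf_main hα i).1.1
    simpa using this
  have := hS.to_subtype
  let φ : ℕ → S × S × ZMod 2 := fun i => (⟨Y i, hYS i⟩, ⟨Z i, hZS i⟩, (i : ZMod 2))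
  obtain ⟨i, j, hij, he⟩ := Finite.exists_ne_map_eq_of_infinite φ
  have key : ∀ i j, i < j → φ i = φ j → ∃ s : ℕ × ℕ, PeriodWindow α s.1 s.2 := by
    intro i j hij he
    simp only [φ, Prod.mk.injEq, Subtype.mk.injEq] at he
    obtain ⟨e1, e2, e3⟩ := he
    have e4 : (-1 : LaurentSeries K) ^ i = (-1) ^ j := by
      rw [ZMod.natCast_eq_natCast_iff] at e3
      have e5 : i % 2 = j % 2 := e3
      rw [neg_one_pow_eq_pow_mod_two, e5, ← neg_one_pow_eq_pow_mod_two]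
    have e6 : cfQuot α (i + 1) = cfQuot α (j + 1) := by
      apply mul_right_cancel₀ (hY0 i)
      rw [hX, e1, hX, e2, e4]
    have e7 : ∀ m, cfQuot α (i + 1 + m) = cfQuot α (j + 1 + m) := by
      intro m
      induction m with
      | zero => exact e6
      | succ m ih =>
        rw [← add_assoc, ← add_assoc, cfQuot, cfQuot, ih]
    refine ⟨(i, j - i), by simp only; omega, ?_⟩
    intro m hm
    simp only at hm ⊢
    have := e7 (m - (i + 1))
    rw [cfPQ, cfPQ, show m + (j - i) = j + 1 + (m - (i + 1)) by omega, ← this]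
    congr 2; omega
  rcases lt_or_gt_of_ne hij with h | h
  · exact key i j h he
  · exact key j i h he.symm

theorem window_tk (p : ℕ) [hp : Fact p.Prime] (hodd : Odd p) (k : ℕ) :
    ∃ s : ℕ × ℕ, PeriodWindow (tLS (ZMod p) ^ k * cantorTheta p) s.1 s.2 := by
  have hd : Deq (tLS (ZMod p) ^ 2 + 1) 2 := by
    have := (deq_t (K := ZMod p)).pow 2
    simpa using this.add deq_one.dle (by norm_num)
  refine window_gen (D := tLS (ZMod p) ^ 2 + 1) (B := tLS (ZMod p) ^ (2 * k)) (irr_tk p hodd k) k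
    ((isP_t.pow 2).add isP_one) (isP_t.pow _) ?_ hd.1 hd.dle ?_
  · have := theta_sq p hodd
    linear_combination tLS (ZMod p) ^ (2 * k) * this
  · refine ((deq_t.pow k).mul (deq_theta p hodd)).dle.mono (by omega)

/-- the square root of `t^2+1` -/
def ss (p : ℕ) [Fact p.Prime] : LaurentSeries (ZMod p) :=
  ((tLS (ZMod p)) ^ 2 + 1) * cantorTheta p

theorem ss_def (p : ℕ) [hp : Fact p.Prime] :
    ss p = ((tLS (ZMod p)) ^ 2 + 1) * cantorTheta p := rfl

theorem theta_ss (p : ℕ) [hp : Fact p.Prime] (hodd : Odd p) : cantorTheta p * ss p = 1 := by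
  rw [ss_def]; linear_combination theta_sq p hodd

theorem ss_sq (p : ℕ) [hp : Fact p.Prime] (hodd : Odd p) : ss p ^ 2 = (tLS (ZMod p)) ^ 2 + 1 := by
  rw [ss_def]; linear_combination ((tLS (ZMod p)) ^ 2 + 1) * theta_sq p hodd

theorem deq_ss (p : ℕ) [hp : Fact p.Prime] (hodd : Odd p) : Deq (ss p) 1 := by
  have h : (cantorTheta p)⁻¹ = ss p := inv_eq_of_mul_eq_one_right (theta_ss p hodd)
  have := (deq_theta p hodd).inv
  rw [h] at this
  simpa using this

theorem deq_D (K : Type*) [Field K] : Deq (tLS K ^ 2 + 1) 2 := by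
  have := (deq_t (K := K)).pow 2
  simpa using this.add deq_one.dle (by norm_num)

theorem two_ne (p : ℕ) [hp : Fact p.Prime] (hodd : Odd p) : (2 : ZMod p) ≠ 0 := by
  have : ((2 : ℕ) : ZMod p) ≠ 0 := by
    rw [Ne, ZMod.natCast_eq_zero_iff]
    intro h
    have := (Nat.prime_dvd_prime_iff_eq hp.out Nat.prime_two).mp h
    subst this
    exact absurd hodd (by decide)
  exact_mod_cast this

theorem theta_coeff (p : ℕ) [hp : Fact p.Prime] : (cantorTheta p).coeff 1 = 1 := by
  have h0 := HahnSeries.coeff_single_mul_add (r := (1 : ZMod p)) (x := cantorTilde p)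
    (a := (0 : ℤ)) (b := (1 : ℤ))
  rw [zero_add] at h0
  rw [cantorTheta, h0, cantorTilde]
  have := HahnSeries.ofPowerSeries_apply_coeff (Γ := ℤ) (PowerSeries.mk fun i => cantor p i) 0
  simp only [Nat.cast_zero] at this
  rw [this]
  simp [cantor]

theorem ss_coeff (p : ℕ) [hp : Fact p.Prime] (hodd : Odd p) : (ss p).coeff (-1) = 1 := by
  rw [ss_def, add_mul, one_mul, tLS_pow, HahnSeries.coeff_add]
  have h1 := (deq_theta p hodd).dle (-1) (by norm_num)
  rw [h1, show (-1 : ℤ) = 1 + (-(2 : ℕ)) by norm_num, HahnSeries.coeff_single_mul_add, theta_coeff]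
  simp

theorem ss_sub (p : ℕ) [hp : Fact p.Prime] (hodd : Odd p) :
    (ss p - tLS (ZMod p)) * (ss p + tLS (ZMod p)) = 1 := by
  linear_combination ss_sq p hodd

theorem dle_ss_sub0 (p : ℕ) [hp : Fact p.Prime] (hodd : Odd p) : Dle (ss p - tLS (ZMod p)) 0 := by
  intro m hm
  by_cases h : m = -1
  · subst h
    rw [HahnSeries.coeff_sub, ss_coeff p hodd]; simp [tLS]
  · exact ((deq_ss p hodd).dle.sub deq_t.dle) m (by omega)

theorem deq_ss_add (p : ℕ) [hp : Fact p.Prime] (hodd : Odd p) : Deq (ss p + tLS (ZMod p)) 1 := by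
  have h2 : Deq (HahnSeries.single (0 : ℤ) (2 : ZMod p) * tLS (ZMod p)) 1 := by
    simpa using (deq_single (0 : ℤ) (two_ne p hodd)).mul (deq_t (K := ZMod p))
  have h3 : (2 : LaurentSeries (ZMod p)) = HahnSeries.single (0 : ℤ) (2 : ZMod p) := by
    exact (map_ofNat (HahnSeries.C (Γ := ℤ) (R := ZMod p)) 2).symm
  have h4 : ss p + tLS (ZMod p) = HahnSeries.single (0 : ℤ) (2 : ZMod p) * tLS (ZMod p)
    + (ss p - tLS (ZMod p)) := by
    rw [← h3]; ring
  rw [h4]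
  exact h2.add (dle_ss_sub0 p hodd) (by norm_num)

theorem deq_ss_sub (p : ℕ) [hp : Fact p.Prime] (hodd : Odd p) : Deq (ss p - tLS (ZMod p)) (-1) := by
  have h : (ss p + tLS (ZMod p))⁻¹ = ss p - tLS (ZMod p) :=
    inv_eq_of_mul_eq_one_left (ss_sub p hodd)
  rw [← h]
  exact (deq_ss_add p hodd).inv

theorem Dle.div {f g : LaurentSeries K} {n m : ℤ} (h : Dle (f * g) n) (hf : Deq f m) :
    Dle g (n - m) := by
  have : g = f⁻¹ * (f * g) := by rw [← mul_assoc, inv_mul_cancel₀ hf.1, one_mul]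
  rw [this]
  exact (hf.inv.dle.mul h).mono (by omega)

theorem decomp (p : ℕ) [hp : Fact p.Prime] (hodd : Odd p) (q : ℕ) (hq : Odd q) (c : ℕ) :
    ∃ x y : LaurentSeries (ZMod p), IsP x ∧ IsP y ∧
      (ss p ^ q - tLS (ZMod p) ^ q) ^ c = x + ss p * y ∧
      Dle x ((q * c : ℕ) : ℤ) ∧ Dle y (((q * c : ℕ) : ℤ) - 1) ∧
      (Odd c → ∃ x', IsP x' ∧ x = tLS (ZMod p) ^ q * x') ∧
      (Even c → ∃ y', IsP y' ∧ y = tLS (ZMod p) ^ q * y') := by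
  obtain ⟨h, rfl⟩ := hq
  set t := tLS (ZMod p) with ht
  set s := ss p with hs
  have hs2 : s ^ 2 = t ^ 2 + 1 := ss_sq p hodd
  set E := (t ^ 2 + 1) ^ h with hE
  have hEP : IsP E := ((isP_t.pow 2).add isP_one).pow h
  have hEd : Dle E (2 * h) := by
    have := ((deq_D (ZMod p)).pow h).dle
    exact this.mono (by omega)
  have hS : s ^ (2 * h + 1) = s * E := by
    rw [pow_succ, pow_mul, hs2, mul_comm]
  have hTd : Deq (t ^ (2 * h + 1)) (2 * h + 1) := by
    have := (deq_t (K := ZMod p)).pow (2 * h + 1)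
    simpa using this
  have hTP : IsP (t ^ (2 * h + 1)) := isP_t.pow _
  have hDd := (deq_D (ZMod p)).dle
  have hDP : IsP (t ^ 2 + 1) := ((isP_t.pow 2).add isP_one)
  rw [hS]
  set T := t ^ (2 * h + 1) with hT
  induction c with
  | zero =>
    refine ⟨1, 0, isP_one, isP_zero, by simp, by simpa using deq_one.dle, Dle.zero _, ?_, ?_⟩
    · intro h; exact absurd h (by decide)
    · intro _; exact ⟨0, isP_zero, by simp⟩
  | succ c ih =>
    obtain ⟨x, y, hx, hy, he, hxd, hyd, ho, hev⟩ := ih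
    refine ⟨(t ^ 2 + 1) * E * y - T * x, x * E - T * y, ((hDP.mul hEP).mul hy).sub (hTP.mul hx),
      (hx.mul hEP).sub (hTP.mul hy), ?_, ?_, ?_, ?_, ?_⟩
    · rw [pow_succ, he]
      linear_combination E * y * hs2
    · refine Dle.sub (((hDd.mul hEd).mul hyd).mono ?_) ((hTd.dle.mul hxd).mono ?_)
      · push_cast; linarith
      · push_cast; linarith
    · refine Dle.sub ((hxd.mul hEd).mono ?_) ((hTd.dle.mul hyd).mono ?_)
      · push_cast; linarith
      · push_cast; linarith
    · intro hc
      have hc' : Even c := by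
        rcases Nat.even_or_odd c with h | h
        · exact h
        · exact absurd hc (by simpa using h.add_one)
      obtain ⟨y', hy', rfl⟩ := hev hc'
      exact ⟨(t ^ 2 + 1) * E * y' - x, ((hDP.mul hEP).mul hy').sub hx, by ring⟩
    · intro hc
      have hc' : Odd c := by
        rcases Nat.even_or_odd c with h | h
        · exact absurd hc (by simpa using h.add_one)
        · exact h
      obtain ⟨x', hx', rfl⟩ := ho hc'
      exact ⟨x' * E - y, (hx'.mul hEP).sub hy, by ring⟩

theorem charP_LS (p : ℕ) [hp : Fact p.Prime] : CharP (LaurentSeries (ZMod p)) p :=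
  charP_of_injective_algebraMap (algebraMap (ZMod p) (LaurentSeries (ZMod p))).injective p

theorem appr_aux (p : ℕ) [hp : Fact p.Prime] (hodd : Odd p) (k d s0 : ℕ) (hs0 : 1 ≤ s0)
    (Q P f : LaurentSeries (ZMod p)) (hQ : IsP Q) (hP : IsP P) (e : ℤ) (hf : Deq f e)
    (he : f = Q * tLS (ZMod p) ^ k - ss p * P) (hd : Dle Q d) (hed : e - 1 ≤ -((d : ℤ) + s0)) :
    Appr (tLS (ZMod p) ^ k * cantorTheta p) s0 d := by
  have h1 : Q * (tLS (ZMod p) ^ k * cantorTheta p) - P = cantorTheta p * f := by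
    rw [he]; linear_combination P * theta_ss p hodd
  have h2 := (deq_theta p hodd).mul hf
  have hF : Deq (Q * (tLS (ZMod p) ^ k * cantorTheta p) - P) (-1 + e) := by rw [h1]; exact h2
  refine ⟨Q, P, hQ, hP, ?_, hd, ?_⟩
  · rintro rfl
    have h3 : Deq (-P) (-1 + e) := by simpa using hF
    have := hP.neg.deg_nonneg h3
    omega
  · exact hF.dle.mono (by omega)

theorem appr_build (p : ℕ) [hp : Fact p.Prime] (hodd : Odd p) (r k a c d s0 : ℕ) (hs0 : 1 ≤ s0)
    (h1 : k ≤ a + p ^ r) (h2 : a + p ^ r * c + 1 ≤ k + d) (h3 : a + d + s0 ≤ p ^ r * c) :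
    Appr (tLS (ZMod p) ^ k * cantorTheta p) s0 d := by
  obtain ⟨x, y, hx, hy, he, hxd, hyd, ho, hev⟩ := decomp p hodd (p ^ r) (hodd.pow) c
  have := charP_LS p
  rw [← sub_pow_char_pow] at he
  have hdeg : Deq ((ss p - tLS (ZMod p)) ^ (p ^ r)) (-(p ^ r : ℕ)) := by
    have := (deq_ss_sub p hodd).pow (p ^ r)
    simpa using this
  have hdeg2 := hdeg.pow c
  rw [he] at hdeg2
  set q := p ^ r with hq
  obtain ⟨b, hb⟩ : ∃ b, b + k = a + q := ⟨a + q - k, by omega⟩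
  have hta := (deq_t (K := ZMod p)).pow a
  have htb := (deq_t (K := ZMod p)).pow b
  have htq := (deq_t (K := ZMod p)).pow q
  have hpw : tLS (ZMod p) ^ b * tLS (ZMod p) ^ k = tLS (ZMod p) ^ a * tLS (ZMod p) ^ q := by
    rw [← pow_add, hb, pow_add]
  have h3' : ((q * c : ℕ) : ℤ) = (q : ℤ) * c := by push_cast; ring
  have h2z : (a : ℤ) + q * c + 1 ≤ k + d := by exact_mod_cast h2
  have h3z : (a : ℤ) + d + s0 ≤ q * c := by exact_mod_cast h3
  have hbz : (b : ℤ) + k = a + q := by exact_mod_cast hb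
  rw [h3'] at hxd hyd
  rcases Nat.even_or_odd c with hc | hc
  · obtain ⟨y', hy', rfl⟩ := hev hc
    have hyd' := hyd.div htq
    refine appr_aux p hodd k d s0 hs0 ((tLS (ZMod p) ^ 2 + 1) * tLS (ZMod p) ^ b * y')
      (-(tLS (ZMod p) ^ a * x)) (ss p * (tLS (ZMod p) ^ a * (x + ss p * (tLS (ZMod p) ^ q * y'))))
      ((((isP_t.pow 2).add isP_one).mul (isP_t.pow b)).mul hy') (((isP_t.pow a).mul hx).neg) _
      ((deq_ss p hodd).mul (hta.mul hdeg2)) ?_ ?_ ?_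
    · linear_combination tLS (ZMod p) ^ a * (tLS (ZMod p) ^ q * y') * ss_sq p hodd -
        (tLS (ZMod p) ^ 2 + 1) * y' * hpw
    · refine (((deq_D (ZMod p)).dle.mul htb.dle).mul hyd').mono ?_
      linarith
    · linarith
  · obtain ⟨x', hx', rfl⟩ := ho hc
    have hxd' := hxd.div htq
    refine appr_aux p hodd k d s0 hs0 (tLS (ZMod p) ^ b * x')
      (-(tLS (ZMod p) ^ a * y)) ((tLS (ZMod p) ^ a * (tLS (ZMod p) ^ q * x' + ss p * y)))
      ((isP_t.pow b).mul hx') (((isP_t.pow a).mul hy).neg) _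
      (hta.mul hdeg2) ?_ ?_ ?_
    · linear_combination - x' * hpw
    · refine (htb.dle.mul hxd').mono ?_
      linarith
    · linarith

def lowPr (q q' k s0 : ℕ) (d : ℕ) : Prop :=
  (1 ≤ d % q ∧ d % q + k + s0 + 1 ≤ 2 * q') ∨ (q + 1 ≤ d % q + k ∧ d % q + s0 + 1 ≤ q)

theorem lower (p : ℕ) [hp : Fact p.Prime] (hodd : Odd p) (k n : ℕ) (hk : 2 ≤ k) :
    (2 : ℝ) / p - 2 * (n + 2) / k ≤ eMassOf (tLS (ZMod p) ^ k * cantorTheta p) n := by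
  have hp1 := hp.out.one_lt
  have hp2 : 3 ≤ p := by
    have := Nat.odd_iff.mp hodd; omega
  obtain ⟨r, hr1, hr2⟩ : ∃ r, p ^ r < k ∧ k ≤ p ^ (r + 1) := by
    have h1 : 0 < Nat.clog p k := Nat.clog_pos hp1 hk
    refine ⟨Nat.clog p k - 1, Nat.pow_pred_clog_lt_self hp1 (by omega), ?_⟩
    rw [Nat.sub_add_cancel h1]
    exact Nat.le_pow_clog hp1 k
  set q' := p ^ r with hq'
  set q := p ^ (r + 1) with hq
  have hqq : q = p * q' := by rw [hq, pow_succ, mul_comm]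
  have hq'0 : 0 < q' := pow_pos hp.out.pos r
  have hq3 : 3 * q' ≤ q := by rw [hqq]; exact Nat.mul_le_mul_right _ hp2
  have hq0 : 0 < q := by omega
  set s0 := n + 1 with hs0
  let pr : ℕ → Prop := lowPr q q' k s0
  have hper : Function.Periodic pr q := by
    intro d; simp only [pr, lowPr, Nat.add_mod_right]
  have hge := eMass_ge (irr_tk p hodd k) (window_tk p hodd k) n q hq0 pr hper (by
    rintro d (⟨h1, h2⟩ | ⟨h1, h2⟩)
    · have hm : d % q' = d % q := by
        rw [← Nat.mod_mod_of_dvd d (show q' ∣ q from ⟨p, by rw [hqq, mul_comm]⟩)]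
        exact Nat.mod_eq_of_lt (by omega)
      have hdm := Nat.div_add_mod d q'
      refine appr_build p hodd r k (k - q') (d / q' + 1) d s0 (by omega) ?_ ?_ ?_
      · omega
      · rw [← hq', mul_add, mul_one]; omega
      · rw [← hq', mul_add, mul_one]; omega
    · have hdm := Nat.div_add_mod d q
      refine appr_build p hodd (r + 1) k 0 (d / q + 1) d s0 (by omega) ?_ ?_ ?_
      · omega
      · rw [← hq, mul_add, mul_one]; omega
      · rw [← hq, mul_add, mul_one]; omega)
  refine le_trans ?_ hge
  have hcount : 2 * q' ≤ q.count pr + 2 * (s0 + 1) := by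
    rw [Nat.count_eq_card_filter_range]
    have hsub : Finset.Ico 1 (2 * q' - k - s0) ∪ Finset.Ico (q + 1 - k) (q - s0) ⊆
        (Finset.range q).filter pr := by
      intro d hd
      rw [Finset.mem_union, Finset.mem_Ico, Finset.mem_Ico] at hd
      have hdq : d < q := by omega
      rw [Finset.mem_filter, Finset.mem_range]
      refine ⟨hdq, ?_⟩
      simp only [pr, lowPr, Nat.mod_eq_of_lt hdq]
      omega
    have hdis : Disjoint (Finset.Ico 1 (2 * q' - k - s0)) (Finset.Ico (q + 1 - k) (q - s0)) := by
      rw [Finset.disjoint_left]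
      intro d h1 h2
      rw [Finset.mem_Ico] at h1 h2
      omega
    have := Finset.card_le_card hsub
    rw [Finset.card_union_of_disjoint hdis, Nat.card_Ico, Nat.card_Ico] at this
    have hfin : 2 * q' ≤ ((Finset.range q).filter pr).card + 2 * (s0 + 1) := by omega
    convert hfin
  have hq0r : (0 : ℝ) < q := by exact_mod_cast hq0
  have hkr : (0 : ℝ) < k := by exact_mod_cast (by omega : 0 < k)
  have hcr : (2 : ℝ) * q' ≤ (q.count pr : ℝ) + 2 * (n + 2) := by
    have : ((2 * q' : ℕ) : ℝ) ≤ ((q.count pr + 2 * (s0 + 1) : ℕ) : ℝ) := by exact_mod_cast hcount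
    rw [hs0] at this
    push_cast at this
    linarith
  have e1 : (2 : ℝ) / p = 2 * q' / q := by
    rw [hqq]; push_cast
    have : (q' : ℝ) ≠ 0 := by exact_mod_cast hq'0.ne'
    have : (p : ℝ) ≠ 0 := by exact_mod_cast hp.out.ne_zero
    field_simp
  have e2 : (2 * (n + 2) : ℝ) / q ≤ 2 * (n + 2) / k := by
    apply div_le_div_of_nonneg_left (by positivity) hkr
    exact_mod_cast hr2
  have e3 : (2 : ℝ) * q' / q ≤ (q.count pr : ℝ) / q + 2 * (n + 2) / q := by
    rw [← add_div]
    exact div_le_div_of_nonneg_right hcr hq0r.le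
  rw [e1]; linarith

theorem algMap_eq (a : K) : (algebraMap K (LaurentSeries K)) a = HahnSeries.single 0 a := by
  simp [HahnSeries.algebraMap_apply']

theorem dle_algMap (a : K) : Dle (algebraMap K (LaurentSeries K) a) 0 := by
  intro m hm
  rw [algMap_eq, HahnSeries.coeff_single_of_ne (by omega)]

theorem dle_sum {ι : Type*} (S : Finset ι) (f : ι → LaurentSeries K) (n : ℤ)
    (h : ∀ i ∈ S, Dle (f i) n) : Dle (∑ i ∈ S, f i) n := by
  induction S using Finset.induction_on with
  | empty => simpa using Dle.zero n
  | insert a S ha ih =>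
    rw [Finset.sum_insert ha]
    exact (h a (Finset.mem_insert_self a S)).add
      (ih fun i hi => h i (Finset.mem_insert_of_mem hi))

theorem dle_aeval_pos {w : LaurentSeries K} (hw : Deq w 1) (G : K[X]) :
    Dle (aeval w G) G.natDegree := by
  rw [aeval_eq_sum_range]
  refine dle_sum _ _ _ fun i hi => ?_
  rw [Algebra.smul_def]
  have := (dle_algMap (G.coeff i)).mul (hw.pow i).dle
  refine this.mono ?_
  have := Finset.mem_range.mp hi
  omega

theorem natDegree_le_of_dle {w : LaurentSeries K} (hw : Deq w 1) (G : K[X]) (n : ℕ)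
    (h : Dle (aeval w G) n) : G.natDegree ≤ n := by
  by_contra hn
  push Not at hn
  have hG : G ≠ 0 := by rintro rfl; simp at hn
  have e : G = monomial G.natDegree G.leadingCoeff + G.eraseLead :=
    by rw [add_comm]; exact (eraseLead_add_monomial_natDegree_leadingCoeff G).symm
  have h1 : Deq (aeval w (monomial G.natDegree G.leadingCoeff)) G.natDegree := by
    rw [aeval_monomial, algMap_eq]
    have := (deq_single (0 : ℤ) (leadingCoeff_ne_zero.mpr hG)).mul (hw.pow G.natDegree)
    simpa using this
  have h2 : Dle (aeval w G.eraseLead) ((G.natDegree : ℤ) - 1) := by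
    refine (dle_aeval_pos hw _).mono ?_
    have := G.eraseLead_natDegree_le
    omega
  have h3 := h1.add h2 (by omega)
  rw [← map_add, ← e] at h3
  have := h3.le h
  omega

theorem dle_aeval_neg {w : LaurentSeries K} (hw : Deq w (-1)) (G : K[X]) :
    Dle (aeval w G) 0 := by
  rw [aeval_eq_sum_range]
  refine dle_sum _ _ _ fun i hi => ?_
  rw [Algebra.smul_def]
  refine ((dle_algMap (G.coeff i)).mul (hw.pow i).dle).mono ?_
  omega

theorem X_pow_dvd_of_dle {w : LaurentSeries K} (hw : Deq w (-1)) (N : ℕ) (H : K[X])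
    (h : Dle (aeval w H) (-(N : ℤ))) : X ^ N ∣ H := by
  induction N generalizing H with
  | zero => simp
  | succ N ih =>
    have e : X * H.divX + C (H.coeff 0) = H := X_mul_divX_add H
    have h1 : Dle (w * aeval w H.divX) (-1) := (hw.dle.mul (dle_aeval_neg hw _)).mono (by omega)
    have e2 : aeval w H = w * aeval w H.divX + HahnSeries.single (0 : ℤ) (H.coeff 0) := by
      conv_lhs => rw [← e]
      rw [map_add, map_mul, aeval_X, aeval_C, algMap_eq]
    have h0 : H.coeff 0 = 0 := by
      have a1 := h 0 (by push_cast; omega)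
      rw [e2, HahnSeries.coeff_add, h1 0 (by norm_num)] at a1
      simpa using a1
    rw [h0] at e e2
    have h3 : Dle (w * aeval w H.divX) (-((N + 1 : ℕ) : ℤ)) := by
      rw [e2] at h; simpa using h
    have h4 := ih H.divX ((h3.div hw).mono (by push_cast; omega))
    rw [← e, map_zero, add_zero, pow_succ, mul_comm]
    exact mul_dvd_mul_left X h4

/-- homogenised substitution -/
def AA (τ : K[X]) (d : ℕ) (Q : K[X]) : K[X] :=
  ∑ j ∈ Finset.range (d + 1), C (Q.coeff j) * τ ^ j * X ^ (d - j)

theorem AA_aeval (τ : K[X]) (d : ℕ) (Q : K[X]) (hQ : Q.natDegree ≤ d) (w t : LaurentSeries K)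
    (h : aeval w τ = t * w) : aeval w (AA τ d Q) = w ^ d * aeval t Q := by
  rw [AA, map_sum, aeval_eq_sum_range' (n := d + 1) (by omega), Finset.mul_sum]
  refine Finset.sum_congr rfl fun j hj => ?_
  have := Finset.mem_range.mp hj
  rw [map_mul, map_mul, map_pow, map_pow, aeval_X, aeval_C, h, Algebra.smul_def, mul_pow]
  have : w ^ d = w ^ j * w ^ (d - j) := by rw [← pow_add]; congr 1; omega
  rw [this]; ring

theorem AA_deg (τ : K[X]) (hτ : τ.natDegree ≤ 2) (d : ℕ) (Q : K[X]) :
    (AA τ d Q).natDegree ≤ 2 * d := by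
  refine natDegree_sum_le_of_forall_le _ _ fun j hj => ?_
  have := Finset.mem_range.mp hj
  refine (natDegree_mul_le).trans ?_
  have h1 : (C (Q.coeff j) * τ ^ j).natDegree ≤ j * 2 :=
    (natDegree_C_mul_le _ _).trans (natDegree_pow_le_of_le j hτ)
  have h2 : (X ^ (d - j) : K[X]).natDegree ≤ d - j := natDegree_X_pow_le _
  omega

def Lam (M ρ : ℕ) : K[X] →ₗ[K] K :=
  Polynomial.lsum fun x => (if x % M = ρ then ((x / M : ℕ) : K) else 0) • LinearMap.id

theorem Lam_monomial (M ρ x : ℕ) (a : K) :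
    Lam M ρ (monomial x a) = (if x % M = ρ then ((x / M : ℕ) : K) else 0) * a := by
  rw [Lam, lsum_apply, sum_monomial_index] <;> split_ifs <;> simp

theorem Lam_kill (M ρ : ℕ) (hM : 0 < M) (F : K[X]) : Lam M ρ (F * (X ^ M - 1) ^ 2) = 0 := by
  induction F using Polynomial.induction_on' with
  | add p q hp hq => rw [add_mul, map_add, hp, hq, add_zero]
  | monomial x a =>
    have e : monomial x a * (X ^ M - 1) ^ 2 =
        monomial (x + M + M) a - monomial (x + M) (2 * a) + monomial x a := by
      simp only [← C_mul_X_pow_eq_monomial, pow_add, map_mul, map_ofNat]; ring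
    rw [e, map_add, map_sub, Lam_monomial, Lam_monomial, Lam_monomial]
    simp only [Nat.add_mod_right, Nat.add_div_right _ hM]
    split_ifs
    · push_cast; ring
    · ring

theorem Lam_eq (M ρ : ℕ) (F : K[X]) :
    Lam M ρ F = ∑ x ∈ F.support, (if x % M = ρ then ((x / M : ℕ) : K) else 0) * F.coeff x := by
  rw [Lam, lsum_apply, Polynomial.sum]
  refine Finset.sum_congr rfl fun x _ => ?_
  split_ifs <;> simp

theorem Lam_low (M ρ : ℕ) (G : K[X]) (hG : G.natDegree < M) : Lam M ρ G = 0 := by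
  rw [Lam_eq]
  refine Finset.sum_eq_zero fun x hx => ?_
  have : x < M := (le_natDegree_of_mem_supp x hx).trans_lt hG
  rw [Nat.div_eq_of_lt this]; simp

theorem Lam_high (M L m : ℕ) (H : K[X]) (h1 : ∀ x, H.coeff x ≠ 0 → L < x ∧ x ≤ L + M)
    (hm : L < m ∧ m ≤ L + M) : Lam M (m % M) H = ((m / M : ℕ) : K) * H.coeff m := by
  rw [Lam_eq, Finset.sum_eq_single m]
  · simp
  · intro x hx hne
    rw [if_neg, zero_mul]
    intro he
    have hx' := h1 x (mem_support_iff.mp hx)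
    apply hne
    have : x ≡ m [MOD M] := he
    rcases le_total x m with hh | hh
    · have := (Nat.modEq_iff_dvd' hh).mp this
      have := Nat.eq_zero_of_dvd_of_lt this (by omega)
      omega
    · have := (Nat.modEq_iff_dvd' hh).mp this.symm
      have := Nat.eq_zero_of_dvd_of_lt this (by omega)
      omega
  · intro hm; rw [notMem_support_iff.mp hm, mul_zero]

/-- the key vanishing argument -/
theorem GH_zero (M L : ℕ) (hM : 0 < M) (G H : K[X]) (hG : G.natDegree < M)
    (h1 : ∀ x, H.coeff x ≠ 0 → L < x ∧ x ≤ L + M)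
    (h2 : ∀ m, L < m → m ≤ L + M → ((m / M : ℕ) : K) ≠ 0)
    (hdvd : (X ^ M - 1) ^ 2 ∣ G + H) : G + H = 0 := by
  have hH : H = 0 := by
    ext m
    by_contra hm
    rw [coeff_zero] at hm
    have hm' := h1 m hm
    obtain ⟨F, hF⟩ := hdvd
    have := Lam_kill M (m % M) hM F
    rw [mul_comm, ← hF, map_add, Lam_low _ _ _ hG, zero_add, Lam_high M L m H h1 hm'] at this
    rcases mul_eq_zero.mp this with h | h
    · exact h2 m hm'.1 hm'.2 h
    · exact hm h
  rw [hH, add_zero] at hdvd ⊢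
  by_contra hG0
  have hmon : (X ^ M - 1 : K[X]).natDegree = M := natDegree_X_pow_sub_C (n := M) (r := (1 : K))
  have := natDegree_le_of_dvd hdvd hG0
  rw [natDegree_pow, hmon] at this
  omega

theorem pow_succ_aux2 (w : LaurentSeries K) (ν k d : ℕ) (h : ν + 1 = k + d) :
    w ^ ν * w = w ^ k * w ^ d := by
  rw [← pow_succ, h, pow_add]

theorem upper_gen (p : ℕ) [hp : Fact p.Prime] [CharP K p] (h : K) (hh : h * 2 = 1)
    (s : LaurentSeries K) (hs : s ^ 2 = tLS K ^ 2 + 1) (hu : Deq (tLS K + s) 1)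
    (hv : Deq (tLS K - s) (-1)) (r d : ℕ) (hp3 : 3 ≤ p) (Q P : K[X])
    (hQ : Q.natDegree ≤ d) (hP : P.natDegree + 1 ≤ 2 * p ^ r + d)
    (hf : Dle (aeval (tLS K) Q * tLS K ^ (2 * p ^ r) - s * aeval (tLS K) P) (-(d : ℤ) - 1))
    (hd : 2 * p ^ r ≤ (2 * p ^ r + d) % (p ^ (r + 1))) : Q = 0 := by
  set q' := p ^ r with hq'
  have hq'0 : 0 < q' := pow_pos hp.out.pos r
  have hqq : p ^ (r + 1) = p * q' := by rw [pow_succ, mul_comm]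
  rw [hqq] at hd
  have hq3 : 3 * q' ≤ p * q' := Nat.mul_le_mul_right _ hp3
  set t := tLS K with ht
  obtain ⟨k, hk⟩ : ∃ k, k = 2 * q' := ⟨_, rfl⟩
  rw [← hk] at hd hf hP
  obtain ⟨ν, hν⟩ : ∃ ν, ν + 1 = k + d := ⟨k + d - 1, by omega⟩
  set τ : K[X] := C h * (X ^ 2 - 1) with hτ
  set σ : K[X] := C h * (X ^ 2 + 1) with hσ
  have hτd : τ.natDegree ≤ 2 := by
    refine (natDegree_C_mul_le _ _).trans ?_
    compute_degree
  have hσd : σ.natDegree ≤ 2 := by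
    refine (natDegree_C_mul_le _ _).trans ?_
    compute_degree
  set η := algebraMap K (LaurentSeries K) h with hη
  have hη2 : η * 2 = 1 := by
    have := congrArg (algebraMap K (LaurentSeries K)) hh
    rw [map_mul, map_one, map_ofNat] at this
    exact this
  have eu : aeval (t + s) τ = t * (t + s) := by
    simp only [hτ, map_mul, map_sub, map_pow, aeval_X, aeval_C, map_one]
    rw [← hη]
    linear_combination η * hs + t * (t + s) * hη2
  have ev : aeval (t - s) τ = t * (t - s) := by
    simp only [hτ, map_mul, map_sub, map_pow, aeval_X, aeval_C, map_one]
    rw [← hη]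
    linear_combination η * hs + t * (t - s) * hη2
  have fu : aeval (t + s) σ = s * (t + s) := by
    simp only [hσ, map_mul, map_add, map_pow, aeval_X, aeval_C, map_one]
    rw [← hη]
    linear_combination -η * hs + s * (t + s) * hη2
  have fv : aeval (t - s) σ = - (s * (t - s)) := by
    simp only [hσ, map_mul, map_add, map_pow, aeval_X, aeval_C, map_one]
    rw [← hη]
    linear_combination -η * hs - s * (t - s) * hη2
  set G := AA τ d Q * τ ^ k - AA τ ν P * σ with hG
  set H := AA τ d Q * τ ^ k + AA τ ν P * σ with hH
  set f := aeval t Q * t ^ k - s * aeval t P with hfdef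
  have gu : aeval (t + s) G = (t + s) ^ (k + d) * f := by
    rw [hG, map_sub, map_mul, map_mul, map_pow, AA_aeval τ d Q hQ _ t eu,
      AA_aeval τ ν P (by omega) _ t eu, eu, fu, hfdef, pow_add, mul_pow]
    linear_combination -(aeval t P * s) * pow_succ_aux2 (t + s) ν k d hν
  have gv : aeval (t - s) H = (t - s) ^ (k + d) * f := by
    rw [hH, map_add, map_mul, map_mul, map_pow, AA_aeval τ d Q hQ _ t ev,
      AA_aeval τ ν P (by omega) _ t ev, ev, fv, hfdef, pow_add, mul_pow]
    linear_combination -(aeval t P * s) * pow_succ_aux2 (t - s) ν k d hν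
  have hGd : G.natDegree ≤ k - 1 := by
    apply natDegree_le_of_dle hu
    rw [gu]
    refine ((hu.pow (k + d)).dle.mul hf).mono ?_
    omega
  have hHd : X ^ (k + d + d + 1) ∣ H := by
    apply X_pow_dvd_of_dle hv
    rw [gv]
    refine ((hv.pow (k + d)).dle.mul hf).mono ?_
    push_cast; omega
  have hHdeg : H.natDegree ≤ 2 * (k + d) := by
    refine natDegree_add_le_of_degree_le ?_ ?_
    · refine natDegree_mul_le.trans ?_
      have a1 := AA_deg τ hτd d Q
      have a2 := natDegree_pow_le_of_le k hτd
      omega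
    · refine natDegree_mul_le.trans ?_
      have a1 := AA_deg τ hτd ν P
      omega
  have hsupp : ∀ x, H.coeff x ≠ 0 → k + d + d < x ∧ x ≤ k + d + d + k := by
    intro x hx
    constructor
    · by_contra hlt
      exact hx (X_pow_dvd_iff.mp hHd x (by omega))
    · have := le_natDegree_of_ne_zero hx
      omega
  have hsum : G + H = (C 2 * AA τ d Q) * τ ^ k := by
    rw [hG, hH]; simp only [map_ofNat]; ring
  have hτk : τ ^ k = C (h ^ k) * (X ^ k - 1) ^ 2 := by
    have hfrob : (X ^ 2 - 1 : K[X]) ^ q' = X ^ k - 1 := by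
      rw [hq', sub_pow_char_pow, ← pow_mul, one_pow, hk]
    rw [hτ, mul_pow, ← C_pow]
    congr 1
    rw [← hfrob, ← pow_mul, hk, mul_comm]
  have hdvd : (X ^ k - 1 : K[X]) ^ 2 ∣ G + H := by
    rw [hsum, hτk]
    exact ⟨C 2 * AA τ d Q * C (h ^ k), by ring⟩
  have hzero := GH_zero k (k + d + d) (by omega) G H (by omega) hsupp (by
    intro m hm1 hm2 h0
    rw [CharP.cast_eq_zero_iff K p] at h0
    obtain ⟨g, hg⟩ := h0
    have hdm := Nat.div_add_mod m k
    have hml := Nat.mod_lt m (show 0 < k by omega)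
    rw [hg] at hdm
    have e1 : k * (p * g) = 2 * (p * q' * g) := by rw [hk]; ring
    rw [e1] at hdm
    have e2 : k + d = (k + d - p * q' * g) + p * q' * g := by omega
    rw [e2, Nat.add_mul_mod_self_left, Nat.mod_eq_of_lt (by omega)] at hd
    omega) hdvd
  rw [hsum] at hzero
  have h20 : (2 : K) ≠ 0 := by
    intro h0; rw [h0] at hh; simp at hh
  have hh0 : h ≠ 0 := by
    intro h0; rw [h0] at hh; simp at hh
  have hτ0 : τ ≠ 0 := by
    rw [hτ]
    refine mul_ne_zero (C_ne_zero.mpr hh0) ?_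
    exact (monic_X_pow_sub_C (1 : K) (two_ne_zero)).ne_zero
  have hA : AA τ d Q = 0 := by
    rcases mul_eq_zero.mp hzero with h1 | h1
    · rcases mul_eq_zero.mp h1 with h2 | h2
      · exact absurd h2 (C_ne_zero.mpr h20)
      · exact h2
    · exact absurd h1 (pow_ne_zero _ hτ0)
  have hB := AA_aeval τ d Q hQ _ t eu
  rw [hA, map_zero] at hB
  rcases mul_eq_zero.mp hB.symm with h1 | h1
  · exact absurd h1 (hu.pow d).1
  · apply aeval_t_injective
    rw [map_zero]; exact h1

def upPr (k q m : ℕ) (d : ℕ) : Prop := (k + d) % q < m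

theorem upPr_count (k q m : ℕ) (hq : 0 < q) (hm : m ≤ q) : q.count (upPr k q m) = m := by
  have h0 : Function.Periodic (fun x => x % q < m) q := by
    intro x; simp
  have h1 := Nat.filter_Ico_card_eq_of_periodic k q (fun x => x % q < m) h0
  have h2 : q.count (fun x => x % q < m) = m := by
    rw [Nat.count_eq_card_filter_range]
    have : (Finset.range q).filter (fun x => x % q < m) = Finset.range m := by
      ext x
      rw [Finset.mem_filter, Finset.mem_range, Finset.mem_range]
      constructor
      · rintro ⟨h1, h2⟩; rwa [Nat.mod_eq_of_lt h1] at h2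
      · intro h; rw [Nat.mod_eq_of_lt (by omega)]; omega
    rw [this, Finset.card_range]
  rw [h2] at h1
  refine Eq.trans ?_ h1
  rw [Nat.count_eq_card_filter_range, Finset.range_eq_Ico]
  apply Finset.card_bij (fun x _ => k + x)
  · intro x hx
    rw [Finset.mem_filter, Finset.mem_Ico] at hx ⊢
    exact ⟨by omega, hx.2⟩
  · intro x _ y _ h; omega
  · intro y hy
    rw [Finset.mem_filter, Finset.mem_Ico] at hy
    refine ⟨y - k, ?_, by omega⟩
    rw [Finset.mem_filter, Finset.mem_Ico]
    refine ⟨by omega, ?_⟩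
    rw [upPr, show k + (y - k) = y by omega]
    exact hy.2

theorem upper (p : ℕ) [hp : Fact p.Prime] (hodd : Odd p) (r n : ℕ) (hn : 1 ≤ n) :
    eMassOf (tLS (ZMod p) ^ (2 * p ^ r) * cantorTheta p) n ≤ 2 / p := by
  have hp3 : 3 ≤ p := by
    have := Nat.odd_iff.mp hodd
    have := hp.out.one_lt
    omega
  have hq'0 : 0 < p ^ r := pow_pos hp.out.pos r
  have hqq : p ^ (r + 1) = p * p ^ r := by rw [pow_succ, mul_comm]
  have hq3 : 3 * p ^ r ≤ p * p ^ r := Nat.mul_le_mul_right _ hp3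
  have h2 := two_ne p hodd
  have hle := eMass_le (irr_tk p hodd (2 * p ^ r)) (window_tk p hodd (2 * p ^ r)) n (p ^ (r + 1))
    (by omega) (upPr (2 * p ^ r) (p ^ (r + 1)) (2 * p ^ r)) (by
      intro d; simp only [upPr, ← add_assoc, Nat.add_mod_right]) (by
      rintro d ⟨Q, P, ⟨Q, rfl⟩, ⟨P, rfl⟩, hQ0, hQd, hF⟩
      by_contra hd
      rw [upPr, not_lt] at hd
      apply hQ0
      have hα := ((deq_t (K := ZMod p)).pow (2 * p ^ r)).mul (deq_theta p hodd)
      have hPd : Dle (aeval (tLS (ZMod p)) P) ((2 * p ^ r + d - 1 : ℕ) : ℤ) := by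
        have e : aeval (tLS (ZMod p)) P = aeval (tLS (ZMod p)) Q *
          (tLS (ZMod p) ^ (2 * p ^ r) * cantorTheta p) - (aeval (tLS (ZMod p)) Q *
          (tLS (ZMod p) ^ (2 * p ^ r) * cantorTheta p) - aeval (tLS (ZMod p)) P) := by ring
        rw [e]
        refine Dle.sub ((hQd.mul hα.dle).mono ?_) (hF.mono ?_)
        · omega
        · omega
      have := dle_aeval_natDegree.mp hPd
      have hQ := upper_gen p (2 : ZMod p)⁻¹ (inv_mul_cancel₀ h2) (ss p) (ss_sq p hodd)
        (by rw [add_comm]; exact deq_ss_add p hodd)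
        (by rw [← neg_sub]; exact (deq_ss_sub p hodd).neg) r d hp3 Q P
        (dle_aeval_natDegree.mp hQd) (by omega) (by
          have e : aeval (tLS (ZMod p)) Q * tLS (ZMod p) ^ (2 * p ^ r) -
              ss p * aeval (tLS (ZMod p)) P = ss p * (aeval (tLS (ZMod p)) Q *
          (tLS (ZMod p) ^ (2 * p ^ r) * cantorTheta p) - aeval (tLS (ZMod p)) P) := by
            linear_combination -(aeval (tLS (ZMod p)) Q * tLS (ZMod p) ^ (2 * p ^ r)) *
              theta_ss p hodd
          rw [e]
          refine ((deq_ss p hodd).dle.mul hF).mono ?_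
          push_cast; omega) hd
      rw [hQ, map_zero])
  rw [upPr_count _ _ _ (by omega) (by omega), hqq] at hle
  refine hle.trans (le_of_eq ?_)
  push_cast
  have : (p : ℝ) ≠ 0 := by exact_mod_cast hp.out.ne_zero
  field_simp

theorem eMass_bdd (p : ℕ) [hp : Fact p.Prime] (hodd : Odd p) (k n : ℕ) :
    0 ≤ eMassP (tLS (ZMod p)) (cantorTheta p) k n ∧
      eMassP (tLS (ZMod p)) (cantorTheta p) k n ≤ 1 := by
  obtain ⟨N, T, a, hT, he, hN, -⟩ := eMass_density (irr_tk p hodd k) (window_tk p hodd k) n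
  rw [eMassP, he]
  refine ⟨by positivity, ?_⟩
  rw [div_le_one (by exact_mod_cast hT)]
  exact_mod_cast hN

theorem liminf_eq (p : ℕ) [hp : Fact p.Prime] (hodd : Odd p) (n : ℕ) (hn : 1 ≤ n) :
    Filter.liminf (fun k : ℕ => eMassP (tLS (ZMod p)) (cantorTheta p) k n) atTop = 2 / p := by
  have hb := eMass_bdd p hodd
  have hbdd : IsBoundedUnder (· ≥ ·) atTop
      (fun k : ℕ => eMassP (tLS (ZMod p)) (cantorTheta p) k n) :=
    isBoundedUnder_of ⟨0, fun k => (hb k n).1⟩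
  have hcob : IsCoboundedUnder (· ≥ ·) atTop
      (fun k : ℕ => eMassP (tLS (ZMod p)) (cantorTheta p) k n) :=
    (isBoundedUnder_of ⟨1, fun k => (hb k n).2⟩ :
      IsBoundedUnder (· ≤ ·) atTop _).isCoboundedUnder_ge
  apply le_antisymm
  · refine liminf_le_of_frequently_le ?_ hbdd
    rw [frequently_atTop]
    intro N
    refine ⟨2 * p ^ N, ?_, upper p hodd N n hn⟩
    have := Nat.lt_pow_self hp.out.one_lt (n := N)
    omega
  · have hlim : Tendsto (fun k : ℕ => (2 : ℝ) / p - 2 * (n + 2) / k) atTop (nhds (2 / p - 0)) :=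
      tendsto_const_nhds.sub (tendsto_const_div_atTop_nhds_zero_nat _)
    rw [sub_zero] at hlim
    rw [← hlim.liminf_eq]
    refine liminf_le_liminf ?_ hlim.isBoundedUnder_ge hcob
    filter_upwards [eventually_ge_atTop 2] with k hk
    exact lower p hodd k n hk

/-- For any odd prime `p`, the Laurent series `Θ_p` is a quadratic
irrational and exhibits exactly `2/p` escape of mass with respect to `{t^k}`. -/
theorem pCantor_quadIrr_and_exact_escape (p : ℕ) [Fact p.Prime] (hodd : Odd p) :
    IsQuadIrr (cantorTheta p) ∧
      ExhibitsExactEscape (tLS (ZMod p)) (cantorTheta p) (2 / p) := by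
  refine ⟨quadIrr p hodd, ?_⟩
  rw [ExhibitsExactEscape]
  refine tendsto_const_nhds.congr' ?_
  filter_upwards [eventually_ge_atTop 1] with n hn
  exact (liminf_eq p hodd n hn).symm

end EscapeOfMass
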